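/- arXiv:2404.17919 — 2 statements merged into one kernel-verified Lean document; each statement's English description precedes it below -/
import Mathlib

section
/- Let A be a free hyperplane arrangement in K^n and let B ⊆ A be a free subarrangement. Let 𝔠 : Der(S) → S be a homogeneous S-module map. Assume (1) the Solomon–Terao algebra ST(A,𝔠) = S/𝔠_A is a finite-dimensional K-vector space, and (2) the quotient polynomial Q(A)/Q(B) does not lie in 𝔠_A. Then 𝔠_B = 𝔠_A : (Q(A)/Q(B)) as ideals in S. -/
open MvPolynomial
noncomputable section
/-- The module of derivations `θ` with `q ∣ θ(q)`; for `q = Q(A)` this is `Der(A)`. -/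
def DerOf (K : Type*) [Field K] (n : ℕ) (q : MvPolynomial (Fin n) K) :
    Submodule (MvPolynomial (Fin n) K)
      (Derivation K (MvPolynomial (Fin n) K) (MvPolynomial (Fin n) K)) where
  carrier := {θ | q ∣ θ q}
  add_mem' := by
    intro a b ha hb
    simpa using dvd_add ha hb
  zero_mem' := by simp
  smul_mem' := by
    intro c θ hθ
    simpa [smul_eq_mul] using Dvd.dvd.mul_left hθ c

/-- A hyperplane arrangement in `K^n`, encoded by a finite set of defining linear
forms: nonzero, homogeneous of degree 1, and pairwise non-proportional (so that the
corresponding hyperplanes are distinct). -/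
def IsArrangement {K : Type*} [Field K] {n : ℕ}
    (A : Finset (MvPolynomial (Fin n) K)) : Prop :=
  (∀ f ∈ A, f ≠ 0 ∧ f.IsHomogeneous 1) ∧
  ∀ f ∈ A, ∀ g ∈ A, f ≠ g → ∀ c : K, g ≠ c • f


lemma koszulX {R : Type*} [CommRing R] {ι : Type*} [DecidableEq ι] (I : Ideal (MvPolynomial ι R))
    (a : ι → MvPolynomial ι R) (ha : ∀ j k, X k * a j - X j * a k ∈ I) (s : Finset ι) :
    ∀ r : ι → MvPolynomial ι R, ∑ j ∈ s, r j * X j = 0 → ∑ j ∈ s, r j * a j ∈ I := by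
  induction s using Finset.induction_on with
  | empty => intro r _; simp
  | insert b s hb ih =>
    intro r hr
    rw [Finset.sum_insert hb] at hr
    have h1 : r b * X b ∈ Ideal.span ((X : ι → MvPolynomial ι R) '' (s : Set ι)) := by
      rw [eq_neg_of_add_eq_zero_left hr]
      refine neg_mem (Ideal.sum_mem _ fun j hj => Ideal.mul_mem_left _ _ (Ideal.subset_span ⟨j, hj, rfl⟩))
    have h2 : r b ∈ Ideal.span ((X : ι → MvPolynomial ι R) '' (s : Set ι)) := by
      rw [mem_ideal_span_X_image] at h1 ⊢
      intro m hm
      obtain ⟨i, hi, hmi⟩ := h1 (m + Finsupp.single b 1) (by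
        rw [mem_support_iff, coeff_mul_X]; exact mem_support_iff.1 hm)
      refine ⟨i, hi, ?_⟩
      have : b ≠ i := by rintro rfl; exact hb hi
      simpa [Finsupp.single_apply, this] using hmi
    have h3 : ∃ q : ι → MvPolynomial ι R, ∑ j ∈ s, q j * X j = r b := by
      have := (Submodule.mem_span_image_finset_iff_exists_fun (MvPolynomial ι R)).1 h2
      obtain ⟨c, hc⟩ := this
      refine ⟨fun j => if h : j ∈ s then c ⟨j, h⟩ else 0, ?_⟩
      rw [← hc, ← Finset.sum_attach]
      exact Finset.sum_congr (by simp) fun j _ => by simp [smul_eq_mul]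
    obtain ⟨q, hq⟩ := h3
    have h4 := ih (fun j => r j + q j * X b) (by
      rw [← hr, ← hq, Finset.sum_mul, ← Finset.sum_add_distrib]
      exact Finset.sum_congr rfl fun j _ => by ring)
    have h5 : ∑ j ∈ s, q j * (X j * a b - X b * a j) ∈ I :=
      Ideal.sum_mem _ fun j _ => Ideal.mul_mem_left _ _ (ha b j)
    have : ∑ j ∈ insert b s, r j * a j = ∑ j ∈ s, q j * (X j * a b - X b * a j) +
        ∑ j ∈ s, (r j + q j * X b) * a j := by
      rw [Finset.sum_insert hb, ← hq, Finset.sum_mul, ← Finset.sum_add_distrib,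
        ← Finset.sum_add_distrib]
      exact Finset.sum_congr rfl fun j _ => by ring
    rw [this]
    exact add_mem h5 h4

lemma koszulV {R : Type*} [CommRing R] {ι : Type*} [DecidableEq ι] [Fintype ι] (y : ι → R)
    (I : Ideal (MvPolynomial ι R))
    (a : ι → MvPolynomial ι R)
    (ha : ∀ j k, (X k - C (y k)) * a j - (X j - C (y j)) * a k ∈ I)
    (r : ι → MvPolynomial ι R) (hr : ∑ j, r j * (X j - C (y j)) = 0) : ∑ j, r j * a j ∈ I := by
  let σ : MvPolynomial ι R →ₐ[R] MvPolynomial ι R := aeval fun j => X j + C (y j)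
  let τ : MvPolynomial ι R →ₐ[R] MvPolynomial ι R := aeval fun j => X j - C (y j)
  have hC : ∀ (f : MvPolynomial ι R →ₐ[R] MvPolynomial ι R) x, f (C x) = C x :=
    fun f x => f.commutes x
  have hτσ : ∀ p, τ (σ p) = p := by
    intro p
    have : τ.comp σ = AlgHom.id R _ := by
      ext1 j
      simp [σ, τ, hC]
    exact DFunLike.congr_fun this p
  have hσ : ∀ j, σ (X j - C (y j)) = X j := by intro j; simp [σ, hC]
  have := koszulX (I.comap τ) (fun j => σ (a j)) (by
    intro j k
    rw [Ideal.mem_comap, ← hσ k, ← hσ j, ← map_mul, ← map_mul, ← map_sub, hτσ]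
    exact ha j k) Finset.univ (fun j => σ (r j)) (by
      have := congrArg σ hr
      rw [map_sum, map_zero] at this
      rw [← this]
      exact Finset.sum_congr rfl fun j _ => by rw [map_mul, hσ])
  rw [Ideal.mem_comap, map_sum] at this
  simpa only [map_mul, hτσ] using this

lemma det_diff {T : Type*} [CommRing T] {ι : Type*} [DecidableEq ι] [Fintype ι] (v : ι → T)
    (I : Ideal T)
    (hv : ∀ a : ι → T, (∀ j k, v k * a j - v j * a k ∈ I) → ∀ r : ι → T,
      ∑ j, r j * v j = 0 → ∑ j, r j * a j ∈ I)
    (D D' : Matrix ι ι T) (h : D.mulVec v = D'.mulVec v) (hI : ∀ i, D.mulVec v i ∈ I) :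
    D.det - D'.det ∈ I := by
  have key : ∀ s : Finset ι,
      (Matrix.of fun i => if i ∈ s then D i else D' i).det - D'.det ∈ I := by
    intro s
    induction s using Finset.induction_on with
    | empty =>
      have : (Matrix.of fun i => if i ∈ (∅ : Finset ι) then D i else D' i) = D' := by
        ext; simp
      rw [this]; simp
    | insert i s hi ih =>
      set H : Matrix ι ι T := Matrix.of fun i => if i ∈ s then D i else D' i with hH
      have e1 : (Matrix.of fun l => if l ∈ insert i s then D l else D' l) = H.updateRow i (D i) := by
        ext l m
        by_cases hl : l = i
        · subst hl; simp
        · simp [hH, hl]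
      have e2 : H = H.updateRow i (D' i) := by
        ext l m
        by_cases hl : l = i
        · subst hl; simp [hH, hi]
        · simp [Matrix.updateRow_ne hl]
      have hHv : ∀ l, H.mulVec v l ∈ I := by
        intro l
        by_cases hl : l ∈ s
        · have : H.mulVec v l = D.mulVec v l := by simp [Matrix.mulVec, hH, hl]
          rw [this]; exact hI l
        · have : H.mulVec v l = D'.mulVec v l := by simp [Matrix.mulVec, hH, hl]
          rw [this, ← h]; exact hI l
      have hlin : ∀ u : ι → T, (H.updateRow i u).det = ∑ l, u l * H.adjugate l i := by
        intro u
        rw [Matrix.det_eq_sum_mul_adjugate_row _ i]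
        refine Finset.sum_congr rfl fun l _ => ?_
        rw [Matrix.adjugate_apply, Matrix.adjugate_apply, Matrix.updateRow_idem,
          Matrix.updateRow_self]
      have e3 : (H.updateRow i (D i)).det - H.det ∈ I := by
        have : H.det = ∑ l, D' i l * H.adjugate l i := by rw [← hlin, ← e2]
        rw [this, hlin, ← Finset.sum_sub_distrib]
        simp_rw [← sub_mul]
        apply hv (fun l => H.adjugate l i)
        · intro j k
          set F := H.updateRow i (Pi.single j (1 : T)) with hF
          have hd : F.det = H.adjugate j i := by rw [Matrix.adjugate_apply]
          have hk : F.adjugate k i = H.adjugate k i := by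
            rw [Matrix.adjugate_apply, Matrix.adjugate_apply, hF, Matrix.updateRow_idem]
          have h6 : ∑ l, F.adjugate k l * F.mulVec v l = F.det * v k := by
            have := congrFun (congrArg (fun A => A.mulVec v) F.adjugate_mul) k
            rw [← Matrix.mulVec_mulVec] at this
            rw [Matrix.smul_mulVec, Matrix.one_mulVec] at this
            exact this
          rw [← Finset.add_sum_erase _ _ (Finset.mem_univ i), hk, hd] at h6
          have h7 : F.mulVec v i = v j := by simp [hF, Matrix.mulVec]
          rw [h7] at h6
          have : v k * H.adjugate j i - v j * H.adjugate k i =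
              ∑ l ∈ Finset.univ.erase i, F.adjugate k l * F.mulVec v l := by
            linear_combination -h6
          show v k * H.adjugate j i - v j * H.adjugate k i ∈ I
          rw [this]
          refine Ideal.sum_mem _ fun l hl => Ideal.mul_mem_left _ _ ?_
          have hl' := Finset.ne_of_mem_erase hl
          have : F.mulVec v l = H.mulVec v l := by
            simp [hF, Matrix.mulVec, Matrix.updateRow_ne hl']
          rw [this]; exact hHv l
        · have := congrFun h i
          simp only [Matrix.mulVec, dotProduct] at this
          simp_rw [sub_mul]
          rw [Finset.sum_sub_distrib, this, sub_self]
      rw [e1]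
      have := add_mem e3 ih
      simpa using this
  have := key Finset.univ
  have e : (Matrix.of fun i => if i ∈ (Finset.univ : Finset ι) then D i else D' i) = D := by
    ext; simp
  rwa [e] at this

/-- residue functional -/
lemma exists_residue {L : Type*} [CommRing L] [Nontrivial L] {ι : Type*} [DecidableEq ι] [Fintype ι]
    (p q : ι → Polynomial L) (hp : ∀ i, (p i).Monic) (hq : ∀ i, (q i).Monic)
    (hpq : ∀ i, (p i).natDegree = (q i).natDegree + 1) :
    ∃ φ : MvPolynomial ι L →ₗ[L] L,
      (∀ t i, φ (t * Polynomial.aeval (X i) (p i)) = 0) ∧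
      φ (∏ i, Polynomial.aeval (X i) (q i)) = 1 := by
  let φ₁ : ι → Polynomial L →ₗ[L] L := fun i =>
    (Polynomial.lcoeff L (q i).natDegree).comp (Polynomial.modByMonicHom (p i))
  let φ : MvPolynomial ι L →ₗ[L] L :=
    (basisMonomials ι L).constr L (fun e => ∏ i, φ₁ i (Polynomial.X ^ (e i)))
  have hmon : ∀ e : ι →₀ ℕ, φ (monomial e 1) = ∏ i, φ₁ i (Polynomial.X ^ (e i)) := by
    intro e
    have := (basisMonomials ι L).constr_basis L (fun e => ∏ i, φ₁ i (Polynomial.X ^ (e i))) e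
    rwa [coe_basisMonomials] at this
  have hprod : ∀ f : ι → Polynomial L,
      φ (∏ i, Polynomial.aeval (X i) (f i)) = ∏ i, φ₁ i (f i) := by
    have : φ.compMultilinearMap ((MultilinearMap.mkPiAlgebra L ι (MvPolynomial ι L)).compLinearMap
        (fun i => (Polynomial.aeval (X i : MvPolynomial ι L)).toLinearMap)) =
        (MultilinearMap.mkPiAlgebra L ι L).compLinearMap φ₁ := by
      refine Module.Basis.ext_multilinear (fun _ => Polynomial.basisMonomials L) ?_
      intro e
      simp only [LinearMap.compMultilinearMap_apply, MultilinearMap.compLinearMap_apply,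
        Polynomial.coe_basisMonomials, MultilinearMap.mkPiAlgebra_apply, AlgHom.toLinearMap_apply,
        Polynomial.monomial_one_right_eq_X_pow, map_pow, Polynomial.aeval_X]
      have h := hmon (Finsupp.equivFunOnFinite.symm e)
      simp only [Finsupp.equivFunOnFinite_symm_apply_apply] at h
      rw [← h, monomial_eq, Finsupp.prod_fintype _ _ (by simp)]
      simp
    intro f
    exact DFunLike.congr_fun this f
  refine ⟨φ, ?_, ?_⟩
  · intro t i
    have hlin : φ.comp (LinearMap.mulRight L (Polynomial.aeval (X i : MvPolynomial ι L) (p i))) = 0 := by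
      refine (basisMonomials ι L).ext fun e => ?_
      have : (monomial e (1:L)) * Polynomial.aeval (X i : MvPolynomial ι L) (p i) =
          ∏ j, Polynomial.aeval (X j : MvPolynomial ι L)
            (Polynomial.X ^ (e j) * if j = i then p i else 1) := by
        simp only [map_mul, Finset.prod_mul_distrib]
        congr 1
        · rw [monomial_eq, Finsupp.prod_fintype _ _ (by simp)]
          simp
        · rw [Finset.prod_eq_single i]
          · simp
          · intro b _ hb; simp [hb]
          · simp
      simp only [coe_basisMonomials, LinearMap.comp_apply, LinearMap.mulRight_apply,
        LinearMap.zero_apply]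
      rw [this, hprod]
      apply Finset.prod_eq_zero (Finset.mem_univ i)
      simp only [if_true, φ₁, LinearMap.comp_apply, Polynomial.modByMonicHom_apply]
      rw [(Polynomial.modByMonic_eq_zero_iff_dvd (hp i)).2 (dvd_mul_left _ _)]
      simp
    exact DFunLike.congr_fun hlin t
  · rw [hprod]
    apply Finset.prod_eq_one
    intro i _
    simp only [φ₁, LinearMap.comp_apply, Polynomial.modByMonicHom_apply]
    rw [(Polynomial.modByMonic_eq_self_iff (hp i)).2]
    · exact hq i
    · apply Polynomial.degree_lt_degree
      rw [hpq i]; exact Nat.lt_succ_self _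

lemma wiebe0 {K : Type*} [Field K] {ι : Type*} [DecidableEq ι] [Fintype ι]
    {L : Type*} [CommRing L] [Nontrivial L] [Algebra K L] (ev : MvPolynomial ι K →ₐ[K] L)
    (p : ι → Polynomial K) (hp : ∀ i, (p i).Monic)
    (M : Matrix ι ι (MvPolynomial ι K)) (g : ι → MvPolynomial ι K)
    (h : ∀ i, Polynomial.aeval (X i) (p i) = ∑ k, M i k * g k)
    (hg : ∀ k, ev (g k) = 0) (a : MvPolynomial ι K)
    (ha : a * M.det ∈ Ideal.span (Set.range fun i =>
      (Polynomial.aeval (X i) (p i) : MvPolynomial ι K))) :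
    ev a = 0 := by
  let y : ι → L := fun i => ev (X i)
  let m : MvPolynomial ι K →ₐ[K] MvPolynomial ι L := aeval X
  have hmX : ∀ i, m (X i) = X i := fun i => by simp [m]
  let v : ι → MvPolynomial ι L := fun j => X j - C (y j)
  let P : ι → Polynomial L := fun i => (p i).map (algebraMap K L)
  have hP : ∀ i, (P i).Monic := fun i => (hp i).map _
  have hPm : ∀ i, Polynomial.aeval (X i : MvPolynomial ι L) (P i) =
      m (Polynomial.aeval (X i) (p i)) := by
    intro i
    rw [← Polynomial.aeval_algHom_apply, hmX, Polynomial.aeval_map_algebraMap]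
  have hroot : ∀ i, (P i).IsRoot (y i) := by
    intro i
    rw [Polynomial.IsRoot.def, Polynomial.eval_map_algebraMap]
    show Polynomial.aeval (ev (X i)) (p i) = 0
    rw [Polynomial.aeval_algHom_apply, h, map_sum]
    exact Finset.sum_eq_zero fun k _ => by rw [map_mul, hg, mul_zero]
  let Q : ι → Polynomial L := fun i => (P i) /ₘ (Polynomial.X - Polynomial.C (y i))
  have hPQ : ∀ i, (Polynomial.X - Polynomial.C (y i)) * Q i = P i := fun i =>
    Polynomial.mul_divByMonic_eq_iff_isRoot.2 (hroot i)
  have hQ : ∀ i, (Q i).Monic := by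
    intro i
    exact (Polynomial.monic_X_sub_C (y i)).of_mul_monic_left (by rw [hPQ]; exact hP i)
  have hdeg : ∀ i, (P i).natDegree = (Q i).natDegree + 1 := by
    intro i
    rw [← hPQ i, (Polynomial.monic_X_sub_C (y i)).natDegree_mul (hQ i),
      Polynomial.natDegree_X_sub_C, add_comm]
  obtain ⟨φ, hφ0, hφ1⟩ := exists_residue P Q hP hQ hdeg
  let I : Ideal (MvPolynomial ι L) :=
    Ideal.span (Set.range fun i => (Polynomial.aeval (X i) (P i) : MvPolynomial ι L))
  have hφI : ∀ t ∈ I, φ t = 0 := by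
    intro t ht
    obtain ⟨c, rfl⟩ := Ideal.mem_span_range_iff_exists_fun.1 ht
    rw [map_sum]
    exact Finset.sum_eq_zero fun i _ => hφ0 _ _
  have hIm : ∀ i, m (Polynomial.aeval (X i) (p i)) ∈ I := by
    intro i; rw [← hPm]; exact Ideal.subset_span ⟨i, rfl⟩
  -- divided differences
  have hdd : ∀ f : MvPolynomial ι K, m f - C (ev f) ∈ Ideal.span (Set.range v) := by
    intro f
    have : (Ideal.Quotient.mkₐ K (Ideal.span (Set.range v))).comp m =
        (Ideal.Quotient.mkₐ K (Ideal.span (Set.range v))).comp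
          ((IsScalarTower.toAlgHom K L (MvPolynomial ι L)).comp ev) := by
      ext1 i
      simp only [AlgHom.comp_apply, hmX]
      exact Ideal.Quotient.eq.2 (Ideal.subset_span ⟨i, rfl⟩)
    exact Ideal.Quotient.eq.1 (DFunLike.congr_fun this f)
  have hdg : ∀ k, ∃ c : ι → MvPolynomial ι L, ∑ j, c j * v j = m (g k) := by
    intro k
    have := hdd (g k)
    rw [hg, map_zero, sub_zero] at this
    exact Ideal.mem_span_range_iff_exists_fun.1 this
  choose Dg hDg using hdg
  let D : Matrix ι ι (MvPolynomial ι L) := (M.map m) * Matrix.of Dg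
  let D' : Matrix ι ι (MvPolynomial ι L) :=
    Matrix.diagonal fun i => Polynomial.aeval (X i : MvPolynomial ι L) (Q i)
  have hDv : ∀ i, D.mulVec v i = m (Polynomial.aeval (X i) (p i)) := by
    intro i
    have : (Matrix.of Dg).mulVec v = fun k => m (g k) := by
      ext1 k; exact hDg k
    rw [show D = (M.map m) * Matrix.of Dg from rfl, ← Matrix.mulVec_mulVec, this, h, map_sum]
    simp [Matrix.mulVec, dotProduct]
  have hvQ : ∀ i, v i * Polynomial.aeval (X i : MvPolynomial ι L) (Q i) =
      Polynomial.aeval (X i : MvPolynomial ι L) (P i) := by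
    intro i
    rw [← hPQ i, map_mul, map_sub, Polynomial.aeval_X, Polynomial.aeval_C]
    rfl
  have hD'v : ∀ i, D'.mulVec v i = m (Polynomial.aeval (X i) (p i)) := by
    intro i
    rw [Matrix.mulVec_diagonal, mul_comm, hvQ, hPm]
  have hdet : D.det - D'.det ∈ I := by
    refine det_diff v I (fun a ha r hr => koszulV y I a ha r hr) D D' ?_ ?_
    · ext1 i; rw [hDv, hD'v]
    · intro i; rw [hDv]; exact hIm i
  have hD'det : D'.det = ∏ i, Polynomial.aeval (X i : MvPolynomial ι L) (Q i) :=
    Matrix.det_diagonal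
  have h1 : (m a - C (ev a)) * D'.det ∈ I := by
    obtain ⟨c, hc⟩ := Ideal.mem_span_range_iff_exists_fun.1 (hdd a)
    rw [← hc, Finset.sum_mul]
    refine Ideal.sum_mem _ fun j _ => ?_
    rw [hD'det, ← Finset.mul_prod_erase _ _ (Finset.mem_univ j)]
    have : c j * v j * (Polynomial.aeval (X j : MvPolynomial ι L) (Q j) *
        ∏ x ∈ Finset.univ.erase j, Polynomial.aeval (X x : MvPolynomial ι L) (Q x)) =
        c j * (∏ x ∈ Finset.univ.erase j, Polynomial.aeval (X x : MvPolynomial ι L) (Q x)) *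
          Polynomial.aeval (X j : MvPolynomial ι L) (P j) := by
      rw [← hvQ]; ring
    rw [this]
    exact Ideal.mul_mem_left _ _ (Ideal.subset_span ⟨j, rfl⟩)
  have h2 : m a * D.det ∈ I := by
    have e : m a * D.det = m (a * M.det) * (Matrix.of Dg).det := by
      rw [show D = (M.map m) * Matrix.of Dg from rfl, Matrix.det_mul, map_mul,
        AlgHom.map_det, AlgHom.mapMatrix_apply, mul_assoc]
    rw [e]
    apply Ideal.mul_mem_right
    obtain ⟨c, hc⟩ := Ideal.mem_span_range_iff_exists_fun.1 ha
    rw [← hc, map_sum]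
    refine Ideal.sum_mem _ fun j _ => ?_
    rw [map_mul]
    exact Ideal.mul_mem_left _ _ (hIm j)
  have h3 : C (ev a) * D'.det ∈ I := by
    have e : C (ev a) * D'.det = m a * D.det - m a * (D.det - D'.det) -
      (m a - C (ev a)) * D'.det := by ring
    rw [e]
    exact sub_mem (sub_mem h2 (Ideal.mul_mem_left _ _ hdet)) h1
  have h4 := hφI _ h3
  rw [hD'det, ← smul_eq_C_mul, map_smul, hφ1, smul_eq_mul, mul_one] at h4
  exact h4

lemma wiebe {K : Type*} [Field K] {ι : Type*} [DecidableEq ι] [Fintype ι]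
    (p : ι → Polynomial K) (hp : ∀ i, (p i).Monic)
    (M : Matrix ι ι (MvPolynomial ι K)) (g : ι → MvPolynomial ι K)
    (h : ∀ i, Polynomial.aeval (X i) (p i) = ∑ k, M i k * g k)
    (a : MvPolynomial ι K)
    (ha : a * M.det ∈ Ideal.span (Set.range fun i =>
      (Polynomial.aeval (X i) (p i) : MvPolynomial ι K))) :
    a ∈ Ideal.span (Set.range g) := by
  by_cases hJt : Ideal.span (Set.range g) = ⊤
  · rw [hJt]; trivial
  have hnt : Nontrivial (MvPolynomial ι K ⧸ Ideal.span (Set.range g)) :=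
    Ideal.Quotient.nontrivial_iff.2 hJt
  have := wiebe0 (Ideal.Quotient.mkₐ K (Ideal.span (Set.range g))) p hp M g h
    (fun k => Ideal.Quotient.eq_zero_iff_mem.2 (Ideal.subset_span ⟨k, rfl⟩)) a ha
  exact Ideal.Quotient.eq_zero_iff_mem.1 this

lemma wiebe' {K : Type*} [Field K] {ι : Type*} [DecidableEq ι] [Fintype ι]
    (M : Matrix ι ι (MvPolynomial ι K)) (f g : ι → MvPolynomial ι K)
    (h : ∀ i, f i = ∑ k, M i k * g k)
    (hfin : FiniteDimensional K (MvPolynomial ι K ⧸ Ideal.span (Set.range f)))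
    (a : MvPolynomial ι K) :
    a * M.det ∈ Ideal.span (Set.range f) ↔ a ∈ Ideal.span (Set.range g) := by
  constructor
  · intro ha
    have : ∀ i : ι, ∃ p : Polynomial K, p.Monic ∧
        (Polynomial.aeval (X i) p : MvPolynomial ι K) ∈ Ideal.span (Set.range f) := by
      intro i
      obtain ⟨p, hp, h0⟩ := Algebra.IsIntegral.isIntegral (R := K)
        (Ideal.Quotient.mkₐ K (Ideal.span (Set.range f)) (X i))
      refine ⟨p, hp, ?_⟩
      change Polynomial.aeval _ p = 0 at h0
      rw [Polynomial.aeval_algHom_apply] at h0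
      exact Ideal.Quotient.eq_zero_iff_mem.1 h0
    choose p hp hpf using this
    have : ∀ i, ∃ c : ι → MvPolynomial ι K, ∑ j, c j * f j = Polynomial.aeval (X i) (p i) :=
      fun i => Ideal.mem_span_range_iff_exists_fun.1 (hpf i)
    choose N hN using this
    have hf : f = M.mulVec g := by ext1 i; rw [h]; rfl
    have hN' : (Matrix.of N).mulVec f = fun i => Polynomial.aeval (X i) (p i) := by
      ext1 i; exact hN i
    refine wiebe p hp (Matrix.of N * M) g ?_ a ?_
    · intro i
      have := congrFun hN' i
      rw [hf, Matrix.mulVec_mulVec] at this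
      exact this.symm
    · obtain ⟨c, hc⟩ := Ideal.mem_span_range_iff_exists_fun.1 ha
      rw [Matrix.det_mul]
      have e : a * ((Matrix.of N).det * M.det) = ∑ i, c i * ((Matrix.of N).det * f i) := by
        calc _ = (Matrix.of N).det * (a * M.det) := by ring
          _ = _ := by rw [← hc, Finset.mul_sum]; exact Finset.sum_congr rfl fun i _ => by ring
      rw [e]
      refine Ideal.sum_mem _ fun i _ => Ideal.mul_mem_left _ _ ?_
      have := congrFun (congrArg (fun A => A.mulVec f) (Matrix.of N).adjugate_mul) i
      rw [← Matrix.mulVec_mulVec, Matrix.smul_mulVec, Matrix.one_mulVec, hN'] at this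
      rw [← smul_eq_mul, ← Pi.smul_apply, ← this]
      refine Ideal.sum_mem _ fun j _ => Ideal.mul_mem_left _ _ (Ideal.subset_span ⟨j, rfl⟩)
  · intro ha
    have hf : f = M.mulVec g := by ext1 i; rw [h]; rfl
    obtain ⟨c, rfl⟩ := Ideal.mem_span_range_iff_exists_fun.1 ha
    rw [Finset.sum_mul]
    refine Ideal.sum_mem _ fun i _ => ?_
    rw [mul_assoc]
    refine Ideal.mul_mem_left _ _ ?_
    have := congrFun (congrArg (fun A => A.mulVec g) M.adjugate_mul) i
    rw [← Matrix.mulVec_mulVec, Matrix.smul_mulVec, Matrix.one_mulVec, ← hf] at this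
    rw [mul_comm, ← smul_eq_mul, ← Pi.smul_apply, ← this]
    refine Ideal.sum_mem _ fun j _ => Ideal.mul_mem_left _ _ (Ideal.subset_span ⟨j, rfl⟩)

section Arr
variable {K : Type*} [Field K] {n : ℕ}

lemma IsArrangement.prime {A : Finset (MvPolynomial (Fin n) K)} (hA : IsArrangement A)
    {f : MvPolynomial (Fin n) K} (hf : f ∈ A) : Prime f := by
  rw [← irreducible_iff_prime]
  obtain ⟨h0, h1⟩ := hA.1 f hf
  refine irreducible_of_totalDegree_eq_one (h1.totalDegree h0) ?_
  intro x hx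
  obtain ⟨m, hm⟩ := ne_zero_iff.1 h0
  rw [isUnit_iff_ne_zero]
  rintro rfl
  exact hm (zero_dvd_iff.1 (hx m))

lemma IsArrangement.not_dvd {A : Finset (MvPolynomial (Fin n) K)} (hA : IsArrangement A)
    {f g : MvPolynomial (Fin n) K} (hf : f ∈ A) (hg : g ∈ A) (hfg : f ≠ g) : ¬ f ∣ g := by
  intro h
  obtain ⟨u, hu⟩ := (hA.prime hf).associated_of_dvd (hA.prime hg) h
  obtain ⟨r, _, hr⟩ := (isUnit_iff_eq_C_of_isReduced).1 u.isUnit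
  refine hA.2 f hf g hg hfg r ?_
  rw [← hu, hr, smul_eq_C_mul, mul_comm]

lemma IsArrangement.subset {A B : Finset (MvPolynomial (Fin n) K)} (hA : IsArrangement A)
    (h : B ⊆ A) : IsArrangement B :=
  ⟨fun f hf => hA.1 f (h hf), fun f hf g hg => hA.2 f (h hf) g (h hg)⟩

lemma IsArrangement.prod_dvd {A : Finset (MvPolynomial (Fin n) K)} (hA : IsArrangement A)
    {z : MvPolynomial (Fin n) K} (h : ∀ f ∈ A, f ∣ z) : (∏ f ∈ A, f) ∣ z := by
  refine Finset.prod_dvd_of_isRelPrime (s := fun f => f) ?_ h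
  intro f hf g hg hfg
  exact (hA.prime hf).irreducible.isRelPrime_iff_not_dvd.2 (hA.not_dvd hf hg hfg)

lemma IsArrangement.prod_ne_zero {A : Finset (MvPolynomial (Fin n) K)} (hA : IsArrangement A) :
    (∏ f ∈ A, f) ≠ 0 :=
  Finset.prod_ne_zero_iff.2 fun f hf => (hA.1 f hf).1

lemma mem_DerOf_iff [DecidableEq (MvPolynomial (Fin n) K)]
    {A : Finset (MvPolynomial (Fin n) K)} (hA : IsArrangement A)
    (θ : Derivation K (MvPolynomial (Fin n) K) (MvPolynomial (Fin n) K)) :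
    θ ∈ DerOf K n (∏ f ∈ A, f) ↔ ∀ f ∈ A, f ∣ θ f := by
  have key : ∀ f ∈ A, θ (∏ f ∈ A, f) =
      f * θ (∏ g ∈ A.erase f, g) + (∏ g ∈ A.erase f, g) * θ f := by
    intro f hf
    rw [← Finset.mul_prod_erase A (fun f => f) hf, Derivation.leibniz, smul_eq_mul, smul_eq_mul]
  change (∏ f ∈ A, f) ∣ θ (∏ f ∈ A, f) ↔ _
  constructor
  · intro h f hf
    have h1 : f ∣ θ (∏ f ∈ A, f) := (Finset.dvd_prod_of_mem (fun f => f) hf).trans h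
    rw [key f hf] at h1
    have h2 := (dvd_add_right (dvd_mul_right f _)).1 h1
    refine ((hA.prime hf).dvd_or_dvd h2).resolve_left ?_
    intro h3
    obtain ⟨g, hg, hfg⟩ := (hA.prime hf).exists_mem_finset_dvd h3
    exact hA.not_dvd hf (Finset.mem_of_mem_erase hg) (Finset.ne_of_mem_erase hg).symm hfg
  · intro h
    refine hA.prod_dvd fun f hf => ?_
    rw [key f hf]
    exact dvd_add (dvd_mul_right _ _) ((h f hf).mul_left _)

/-- derivations are vectors -/
def derEquiv (K : Type*) [Field K] (n : ℕ) :
    Derivation K (MvPolynomial (Fin n) K) (MvPolynomial (Fin n) K) ≃ₗ[MvPolynomial (Fin n) K]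
      (Fin n → MvPolynomial (Fin n) K) where
  toFun θ j := θ (X j)
  map_add' _ _ := rfl
  map_smul' _ _ := rfl
  invFun v := mkDerivation K v
  left_inv θ := derivation_ext fun i => by simp [mkDerivation_X]
  right_inv v := by ext1 j; simp [mkDerivation_X]

lemma der_sum {ι : Type*} (s : Finset ι)
    (F : ι → Derivation K (MvPolynomial (Fin n) K) (MvPolynomial (Fin n) K))
    (f : MvPolynomial (Fin n) K) : (∑ j ∈ s, F j) f = ∑ j ∈ s, F j f := by
  classical
  induction s using Finset.induction_on with
  | empty => simp
  | insert a s ha ih => rw [Finset.sum_insert ha, Finset.sum_insert ha, Derivation.add_apply, ih]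

lemma der_apply (θ : Derivation K (MvPolynomial (Fin n) K) (MvPolynomial (Fin n) K))
    (f : MvPolynomial (Fin n) K) : θ f = ∑ j, θ (X j) * pderiv j f := by
  have : θ = ∑ j, θ (X j) • pderiv j := by
    refine derivation_ext fun i => ?_
    simp [der_sum, pderiv_X, Pi.single_apply]
  conv_lhs => rw [this]
  simp [der_sum]

lemma exists_basis {A : Finset (MvPolynomial (Fin n) K)} (hA : IsArrangement A)
    (hfree : Module.Free (MvPolynomial (Fin n) K) (DerOf K n (∏ f ∈ A, f))) :
    Nonempty (Module.Basis (Fin n) (MvPolynomial (Fin n) K) (DerOf K n (∏ f ∈ A, f))) := by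
  have hfinE : Module.Finite (MvPolynomial (Fin n) K)
      (Derivation K (MvPolynomial (Fin n) K) (MvPolynomial (Fin n) K)) :=
    Module.Finite.equiv (derEquiv K n).symm
  have hrk : Module.finrank (MvPolynomial (Fin n) K)
      (Derivation K (MvPolynomial (Fin n) K) (MvPolynomial (Fin n) K)) = n := by
    rw [(derEquiv K n).finrank_eq, Module.finrank_fin_fun]
  have hN : IsNoetherian (MvPolynomial (Fin n) K)
      (Derivation K (MvPolynomial (Fin n) K) (MvPolynomial (Fin n) K)) := inferInstance
  have hfin : Module.Finite (MvPolynomial (Fin n) K) (DerOf K n (∏ f ∈ A, f)) := inferInstance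
  have hle : Module.finrank (MvPolynomial (Fin n) K) (DerOf K n (∏ f ∈ A, f)) ≤ n := by
    conv_rhs => rw [← hrk]
    exact Submodule.finrank_le _
  have hge : n ≤ Module.finrank (MvPolynomial (Fin n) K) (DerOf K n (∏ f ∈ A, f)) := by
    have hmem : ∀ θ : Derivation K (MvPolynomial (Fin n) K) (MvPolynomial (Fin n) K),
        (LinearMap.lsmul (MvPolynomial (Fin n) K) _ (∏ f ∈ A, f)) θ ∈
          DerOf K n (∏ f ∈ A, f) := fun θ => dvd_mul_right _ _
    conv_lhs => rw [← hrk]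
    refine LinearMap.finrank_le_finrank_of_injective
      (f := LinearMap.codRestrict _ (LinearMap.lsmul (MvPolynomial (Fin n) K) _ (∏ f ∈ A, f)) hmem) ?_
    intro θ η h
    have h1 : (∏ f ∈ A, f) • θ = (∏ f ∈ A, f) • η := congrArg Subtype.val h
    refine derivation_ext fun i => ?_
    have h2 := DFunLike.congr_fun h1 (X i)
    exact mul_left_cancel₀ hA.prod_ne_zero h2
  exact ⟨Module.finBasisOfFinrankEq _ _ (le_antisymm hle hge)⟩

lemma exists_coeffs {R E : Type*} [CommRing R] [AddCommGroup E] [Module R E] {W : Submodule R E}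
    {ι : Type*} [Fintype ι] (b : Module.Basis ι R W) (η : ι → E) (hη : ∀ i, η i ∈ W) :
    ∃ N : Matrix ι ι R, ∀ i, η i = ∑ k, N i k • (b k : E) := by
  refine ⟨Matrix.of fun i k => b.repr ⟨η i, hη i⟩ k, fun i => ?_⟩
  have := congrArg Subtype.val (b.sum_repr ⟨η i, hη i⟩)
  rw [Submodule.coe_sum] at this
  exact this.symm

/-- coefficient matrix -/
def cmat (η : Fin n → Derivation K (MvPolynomial (Fin n) K) (MvPolynomial (Fin n) K)) :
    Matrix (Fin n) (Fin n) (MvPolynomial (Fin n) K) := Matrix.of fun i j => η i (X j)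

lemma cmat_eq (η ζ : Fin n → Derivation K (MvPolynomial (Fin n) K) (MvPolynomial (Fin n) K))
    (N : Matrix (Fin n) (Fin n) (MvPolynomial (Fin n) K)) (h : ∀ i, η i = ∑ k, N i k • ζ k) :
    cmat η = N * cmat ζ := by
  ext1 i j
  simp [cmat, h, Matrix.mul_apply, der_sum]

lemma saito [CharZero K] {A : Finset (MvPolynomial (Fin n) K)} (hA : IsArrangement A)
    (b : Module.Basis (Fin n) (MvPolynomial (Fin n) K) (DerOf K n (∏ f ∈ A, f))) :
    Associated (cmat fun i => (b i : Derivation K (MvPolynomial (Fin n) K)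
      (MvPolynomial (Fin n) K))).det (∏ f ∈ A, f) := by
  classical
  set θ : Fin n → Derivation K (MvPolynomial (Fin n) K) (MvPolynomial (Fin n) K) :=
    fun i => (b i : Derivation K (MvPolynomial (Fin n) K) (MvPolynomial (Fin n) K)) with hθ
  have hlin : ∀ f ∈ A, ∃ a : Fin n → K, (∀ j, pderiv j f = C (a j)) ∧ ∃ j, a j ≠ 0 := by
    intro f hf
    obtain ⟨h0, h1⟩ := hA.1 f hf
    have : ∀ j, ∃ r : K, pderiv j f = C r := fun j =>
      ⟨_, totalDegree_eq_zero_iff_eq_C.1 (Nat.le_zero.1 (h1.pderiv (i := j)).totalDegree_le)⟩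
    choose a ha using this
    refine ⟨a, ha, ?_⟩
    by_contra! hcon
    apply h0
    have := h1.sum_X_mul_pderiv
    simpa [ha, hcon] using this.symm
  have hdiv : (∏ f ∈ A, f) ∣ (cmat θ).det := by
    refine hA.prod_dvd fun f hf => ?_
    obtain ⟨a, ha, j, hj⟩ := hlin f hf
    have h1 := congrFun (congrArg (fun B => B.mulVec fun k => pderiv k f) (cmat θ).adjugate_mul) j
    rw [← Matrix.mulVec_mulVec, Matrix.smul_mulVec, Matrix.one_mulVec] at h1
    have h2 : (cmat θ).mulVec (fun k => pderiv k f) = fun i => θ i f := by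
      ext1 i; rw [der_apply (θ i) f]; rfl
    rw [h2, Pi.smul_apply, ha, smul_eq_mul] at h1
    have h3 : f ∣ (cmat θ).det * C (a j) := by
      rw [← h1, Matrix.mulVec, dotProduct]
      refine Finset.dvd_sum fun i _ => ?_
      refine Dvd.dvd.mul_left ?_ _
      exact (mem_DerOf_iff hA _).1 (b i).2 f hf
    have hu : IsUnit (C (a j) : MvPolynomial (Fin n) K) := (isUnit_iff_ne_zero.2 hj).map C
    exact hu.dvd_mul_right.1 h3
  have hdet : ∀ η : Fin n → Derivation K (MvPolynomial (Fin n) K) (MvPolynomial (Fin n) K),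
      (∀ i, η i ∈ DerOf K n (∏ f ∈ A, f)) → (cmat θ).det ∣ (cmat η).det := by
    intro η hη
    obtain ⟨N, hN⟩ := exists_coeffs b η hη
    rw [cmat_eq η θ N hN, Matrix.det_mul]
    exact dvd_mul_left _ _
  obtain ⟨u, hu⟩ := hdiv
  have hQ := hA.prod_ne_zero
  have hall : (cmat θ).det ∣ (∏ f ∈ A, f) ^ n := by
    have := hdet (fun i => (∏ f ∈ A, f) • pderiv i)
      (fun i => dvd_mul_right (∏ f ∈ A, f) (pderiv i (∏ f ∈ A, f)))
    have e : cmat (fun i => (∏ f ∈ A, f) • pderiv i) =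
        (∏ f ∈ A, f) • (1 : Matrix (Fin n) (Fin n) (MvPolynomial (Fin n) K)) := by
      ext1 i j
      simp [cmat, Matrix.one_apply, pderiv_X, Pi.single_apply, eq_comm]
    rw [e, Matrix.det_smul, Matrix.det_one, mul_one, Fintype.card_fin] at this
    exact this
  have hone : ∀ f ∈ A, ¬ f ∣ u := by
    intro f hf hfu
    obtain ⟨a, ha, k, hk⟩ := hlin f hf
    set P := ∏ g ∈ A.erase f, g with hP
    have hQP : ∏ f ∈ A, f = f * P := (Finset.mul_prod_erase A (fun f => f) hf).symm
    let η : Fin n → Derivation K (MvPolynomial (Fin n) K) (MvPolynomial (Fin n) K) := fun i =>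
      if i = k then (f * P) • pderiv k else P • (pderiv i - (C (a i / a k) : MvPolynomial (Fin n) K) • pderiv k)
    have hη : ∀ i, η i ∈ DerOf K n (∏ f ∈ A, f) := by
      intro i
      rw [mem_DerOf_iff hA]
      intro g hg
      by_cases hi : i = k
      · simp only [η, hi, if_true]
        rw [← hQP]
        exact Dvd.dvd.mul_right (Finset.dvd_prod_of_mem (fun f => f) hg) _
      · simp only [η, hi, if_false]
        by_cases hgf : g = f
        · subst hgf
          have : (P • (pderiv i - (C (a i / a k) : MvPolynomial (Fin n) K) • pderiv k) : Derivation K (MvPolynomial (Fin n) K) (MvPolynomial (Fin n) K)) g = 0 := by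
            simp only [Derivation.smul_apply, Derivation.sub_apply, smul_eq_mul, ha, ← C_mul]
            rw [div_mul_cancel₀ _ hk]; simp
          rw [this]; exact dvd_zero _
        · exact Dvd.dvd.mul_right (Finset.dvd_prod_of_mem (fun f => f)
            (Finset.mem_erase.2 ⟨hgf, hg⟩)) _
    let w : Fin n → MvPolynomial (Fin n) K := fun i => if i = k then f * P else P
    let G : Matrix (Fin n) (Fin n) (MvPolynomial (Fin n) K) := Matrix.of fun i j =>
      (1 : Matrix (Fin n) (Fin n) (MvPolynomial (Fin n) K)) i j +
        (if i = k then 0 else - C (a i / a k)) *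
          (1 : Matrix (Fin n) (Fin n) (MvPolynomial (Fin n) K)) k j
    have hG : G.det = 1 := by
      rw [← Matrix.det_one (n := Fin n)]
      exact Matrix.det_eq_of_forall_row_eq_smul_add_const
        (fun i => if i = k then 0 else - C (a i / a k)) k (by simp) (fun i j => rfl)
    have e : cmat η = Matrix.diagonal w * G := by
      ext1 i j
      rw [Matrix.diagonal_mul]
      by_cases hi : i = k
      · subst hi
        simp [cmat, η, w, G, Matrix.one_apply, pderiv_X, Pi.single_apply, eq_comm]
      · have hX : ∀ i j : Fin n, (pderiv i (X j) : MvPolynomial (Fin n) K) =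
            (1 : Matrix (Fin n) (Fin n) (MvPolynomial (Fin n) K)) i j := by
          intro i j
          rw [pderiv_X, Matrix.one_eq_pi_single, Pi.single_comm]
        have e1 : cmat η i j = P * (pderiv i (X j) - C (a i / a k) * pderiv k (X j)) := by
          simp only [cmat, η, Matrix.of_apply, if_neg hi]
          rfl
        rw [e1, hX, hX]
        simp only [w, G, Matrix.of_apply, if_neg hi]
        ring
    have h1 := hdet η hη
    rw [e, Matrix.det_mul, hG, mul_one, Matrix.det_diagonal, hu, hQP,
      ← Finset.mul_prod_erase _ _ (Finset.mem_univ k)] at h1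
    simp only [w, if_true] at h1
    rw [mul_dvd_mul_iff_left (by rw [← hQP]; exact hQ)] at h1
    have h2 := hfu.trans h1
    obtain ⟨i, hi, h3⟩ := (hA.prime hf).exists_mem_finset_dvd h2
    rw [if_neg (Finset.ne_of_mem_erase hi)] at h3
    obtain ⟨g, hg, hfg⟩ := (hA.prime hf).exists_mem_finset_dvd h3
    exact hA.not_dvd hf (Finset.mem_of_mem_erase hg) (Finset.ne_of_mem_erase hg).symm hfg
  have hunit : IsUnit u := by
    by_contra hnu
    have hu0 : u ≠ 0 := by
      rintro rfl
      rw [mul_zero] at hu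
      rw [hu, zero_dvd_iff] at hall
      exact pow_ne_zero _ hQ hall
    obtain ⟨π, hπ, hπu⟩ := WfDvdMonoid.exists_irreducible_factor hnu hu0
    have hπp := hπ.prime
    have h1 : π ∣ (∏ f ∈ A, f) ^ n :=
      (hπu.trans (hu ▸ dvd_mul_left u _)).trans hall
    obtain ⟨f, hf, hπf⟩ := hπp.exists_mem_finset_dvd (hπp.dvd_of_dvd_pow h1)
    exact hone f hf ((hπp.associated_of_dvd (hA.prime hf) hπf).symm.dvd.trans hπu)
  rw [hu]
  exact (associated_mul_unit_left _ _ hunit)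

lemma map_eq_span {R E : Type*} [CommRing R] [AddCommGroup E] [Module R E] {W : Submodule R E}
    {ι : Type*} (b : Module.Basis ι R W) (c : E →ₗ[R] R) :
    Submodule.map c W = Ideal.span (Set.range fun i => c (b i : E)) := by
  have h1 : W = Submodule.span R (Set.range fun i => (b i : E)) := by
    have := congrArg (Submodule.map W.subtype) b.span_eq
    rw [Submodule.map_span, Submodule.map_subtype_top, ← Set.range_comp] at this
    exact this.symm
  conv_lhs => rw [h1]
  rw [Submodule.map_span, ← Set.range_comp]
  rfl

end Arr

theorem statement11 (K : Type*) [Field K] [CharZero K] (n : ℕ)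
    [DecidableEq (MvPolynomial (Fin n) K)] (hn : 0 < n) (d : ℕ)
    (A B : Finset (MvPolynomial (Fin n) K)) (hArr : IsArrangement A) (hBA : B ⊆ A)
    (c : Derivation K (MvPolynomial (Fin n) K) (MvPolynomial (Fin n) K)
      →ₗ[MvPolynomial (Fin n) K] MvPolynomial (Fin n) K)
    (hc : ∀ k : Fin n, (c (pderiv k)).IsHomogeneous d)
    (hfreeA : Module.Free (MvPolynomial (Fin n) K) (DerOf K n (∏ f ∈ A, f)))
    (hfreeB : Module.Free (MvPolynomial (Fin n) K) (DerOf K n (∏ f ∈ B, f)))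
    (hfin : FiniteDimensional K
      (MvPolynomial (Fin n) K ⧸ Submodule.map c (DerOf K n (∏ f ∈ A, f))))
    (hnot : (∏ f ∈ A \ B, f) ∉ Submodule.map c (DerOf K n (∏ f ∈ A, f))) :
    Submodule.map c (DerOf K n (∏ f ∈ B, f)) =
      (Submodule.map c (DerOf K n (∏ f ∈ A, f))).colon
        (Ideal.span {∏ f ∈ A \ B, f}) := by
  obtain ⟨bA⟩ := exists_basis hArr hfreeA
  have hArrB := hArr.subset hBA
  obtain ⟨bB⟩ := exists_basis hArrB hfreeB
  have hsub : ∀ i, (bA i : Derivation K (MvPolynomial (Fin n) K) (MvPolynomial (Fin n) K)) ∈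
      DerOf K n (∏ f ∈ B, f) := fun i => (mem_DerOf_iff hArrB _).2 fun f hf =>
    (mem_DerOf_iff hArr _).1 (bA i).2 f (hBA hf)
  obtain ⟨M, hM⟩ := exists_coeffs bB _ hsub
  have hdet := congrArg Matrix.det (cmat_eq _ _ M hM)
  rw [Matrix.det_mul] at hdet
  have hsA := saito hArr bA
  have hsB := saito hArrB bB
  rw [hdet, ← Finset.prod_sdiff hBA] at hsA
  have hMQ : Associated M.det (∏ f ∈ A \ B, f) :=
    hsA.of_mul_right hsB (hsB.ne_zero_iff.2 hArrB.prod_ne_zero)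
  have hA' := map_eq_span bA c
  have hB' := map_eq_span bB c
  rw [hA'] at hfin
  have hw := wiebe' M (fun i => c (bA i)) (fun i => c (bB i))
    (fun i => by rw [hM i, map_sum]; simp) hfin
  rw [hA', hB']
  ext a
  rw [← hw a, Submodule.mem_colon]
  obtain ⟨u, hu⟩ := hMQ
  constructor
  · intro h s hs
    obtain ⟨t, rfl⟩ := Ideal.mem_span_singleton'.1 hs
    have e : a • (t * ∏ f ∈ A \ B, f) = (t * u) * (a * M.det) := by
      rw [← hu, smul_eq_mul]; ring
    rw [e]
    exact Ideal.mul_mem_left _ _ h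
  · intro h
    refine h _ (Ideal.mem_span_singleton'.2 ⟨(↑u⁻¹ : MvPolynomial (Fin n) K), ?_⟩)
    rw [← hu, mul_comm, mul_assoc, Units.mul_inv, mul_one]
end
end

section
/- Let A be an essential southwest arrangement in K^n with h-sequence (h_1,…,h_n). Then the set of monomials {x_1^{a_1}⋯x_n^{a_n} : a_i < h_i for all i} descends to a K-vector space basis of the Solomon–Terao algebra ST(A,𝔦) = S/𝔦_A. -/
open MvPolynomial

noncomputable section

/-- `varx K n i` is the variable `x_i` for `1 ≤ i ≤ n`, with the convention `x_0 = 0`. -/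
def varx (K : Type*) [Field K] (n : ℕ) (i : Fin (n + 1)) : MvPolynomial (Fin n) K :=
  if h : (i : ℕ) = 0 then 0 else X ⟨(i : ℕ) - 1, by have := i.isLt; omega⟩

/-- The linear form `α_{i,j}`: equal to `x_j` when `i = 0` and `x_i − x_j` when `i ≥ 1`. -/
def alp (K : Type*) [Field K] (n : ℕ) (i j : Fin (n + 1)) : MvPolynomial (Fin n) K :=
  if i = 0 then varx K n j else varx K n i - varx K n j

/-- Defining polynomial `Q(A)` of an arrangement encoded by its index pairs. -/
def QA (K : Type*) [Field K] (n : ℕ) (A : Finset (Fin (n + 1) × Fin (n + 1))) :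
    MvPolynomial (Fin n) K :=
  ∏ p ∈ A, alp K n p.1 p.2

/-- The `S`-module map `𝔦 : Der(S) → S`, `θ ↦ Σ_k θ(x_k)`, i.e. `∂_k ↦ 1`. -/
def iMap (K : Type*) [Field K] (n : ℕ) :
    Derivation K (MvPolynomial (Fin n) K) (MvPolynomial (Fin n) K)
      →ₗ[MvPolynomial (Fin n) K] MvPolynomial (Fin n) K where
  toFun θ := ∑ k : Fin n, θ (X k)
  map_add' := by intro a b; simp [Finset.sum_add_distrib]
  map_smul' := by intro c θ; simp [Finset.mul_sum]

/-- The Solomon–Terao ideal `𝔦_A = 𝔦(Der(A))`. -/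
def iIdeal (K : Type*) [Field K] (n : ℕ) (A : Finset (Fin (n + 1) × Fin (n + 1))) :
    Ideal (MvPolynomial (Fin n) K) :=
  Submodule.map (iMap K n) (DerOf K n (QA K n A))

/-- A subarrangement of the augmented braid arrangement is southwest if
`H_{i,j} ∈ A` and `j > i + 1` imply `H_{i,j-1} ∈ A`. -/
def IsSouthwest {n : ℕ} (A : Finset (Fin (n + 1) × Fin (n + 1))) : Prop :=
  (∀ p ∈ A, p.1 < p.2) ∧
  ∀ p ∈ A, (p.1 : ℕ) + 1 < (p.2 : ℕ) →
    (p.1, (⟨(p.2 : ℕ) - 1, lt_of_le_of_lt (Nat.sub_le _ _) p.2.isLt⟩ : Fin (n + 1))) ∈ A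

/-- The `h`-sequence `h_i(A) = #{0 ≤ k < i : H_{k,i} ∈ A}` (here `i` ranges over `1,…,n`,
encoded by `Fin n` via `i ↦ i+1`). -/
def hseq {n : ℕ} (A : Finset (Fin (n + 1) × Fin (n + 1))) (i : Fin n) : ℕ :=
  (Finset.univ.filter fun k : Fin (n + 1) => k < i.succ ∧ (k, i.succ) ∈ A).card



namespace SWProof

section Span

variable {K S : Type*} [Field K] [CommRing S] [Algebra K S]

/-- The generator attached to the vertex `j`. -/
def Fj (y : ℕ → S) (V : Finset ℕ) (N : ℕ → Finset ℕ) (j : ℕ) : S :=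
  ∑ l ∈ V.filter (fun l => j ≤ l), ∏ k ∈ N j, (y l - y k)

/-- The ideal generated by the inactive variables and the `Fj`. -/
def JJ (y : ℕ → S) (V : Finset ℕ) (N : ℕ → Finset ℕ) : Ideal S :=
  Ideal.span ({s | ∃ i, i ∉ V ∧ s = y i} ∪ {s | ∃ j ∈ V, s = Fj y V N j})

/-- Combinatorial conditions on the lower neighbourhoods. -/
structure Good (V : Finset ℕ) (N : ℕ → Finset ℕ) : Prop where
  zero : 0 ∉ V
  lt : ∀ j ∈ V, ∀ k ∈ N j, k < j
  mem : ∀ j ∈ V, ∀ k ∈ N j, k = 0 ∨ k ∈ V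
  sw : ∀ j ∈ V, ∀ j' ∈ V, j < j' → ∀ k ∈ N j', k < j → k ∈ N j

/-- Allowed monomials. -/
def Mon (y : ℕ → S) (V : Finset ℕ) (N : ℕ → Finset ℕ) : Set S :=
  {s | ∃ a : ℕ → ℕ, (∀ i ∈ V, a i < (N i).card) ∧ s = ∏ i ∈ V, y i ^ a i}

lemma y_mem_JJ {y : ℕ → S} {V N} {i : ℕ} (hi : i ∉ V) : y i ∈ JJ y V N :=
  Ideal.subset_span (Or.inl ⟨i, hi, rfl⟩)

lemma Fj_mem_JJ {y : ℕ → S} {V N} {i : ℕ} (hi : i ∈ V) : Fj y V N i ∈ JJ y V N :=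
  Ideal.subset_span (Or.inr ⟨i, hi, rfl⟩)

lemma tail_mem (y : ℕ → S) {V : Finset ℕ} {N : ℕ → Finset ℕ} (hG : Good V N) (m : ℕ)
    (hm : ∀ i ∈ V, i < m) (d : ℕ) : ∀ (c : ℕ), 1 ≤ c → m ≤ c + d → ∀ (T : Finset ℕ)
    (_ : ∀ j' ∈ V, c ≤ j' → ∀ k ∈ N j', k < c → k ∈ T) (Q : Polynomial S),
    ∑ l ∈ V.filter (fun l => c ≤ l), (∏ k ∈ T, (y l - y k)) * Q.eval (y l) ∈ JJ y V N := by
  induction d with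
  | zero =>
    intro c hc hmc T hT Q
    rw [Finset.filter_false_of_mem]
    · simp
    · intro i hi
      have := hm i hi
      omega
  | succ d ih =>
    intro c hc hmc T hT Q
    by_cases hcV : c ∈ V
    · have hsub : N c ⊆ T := fun k hk => hT c hcV le_rfl k hk (hG.lt c hcV k hk)
      set M : Polynomial S := (∏ k ∈ T \ N c, (Polynomial.X - Polynomial.C (y k))) * Q with hM
      obtain ⟨R, hR⟩ : (Polynomial.X - Polynomial.C (y c)) ∣ M - Polynomial.C (M.eval (y c)) := by
        rw [Polynomial.dvd_iff_isRoot]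
        simp
      have hev : ∀ l, M.eval (y l) = M.eval (y c) + (y l - y c) * R.eval (y l) := by
        intro l
        have := congrArg (Polynomial.eval (y l)) hR
        simp at this
        linear_combination this
      have hprod : ∀ l, (∏ k ∈ T, (y l - y k)) * Q.eval (y l)
          = M.eval (y c) * (∏ k ∈ N c, (y l - y k))
            + (∏ k ∈ N c, (y l - y k)) * ((y l - y c) * R.eval (y l)) := by
        intro l
        have h1 : (∏ k ∈ T, (y l - y k)) * Q.eval (y l)
            = (∏ k ∈ N c, (y l - y k)) * M.eval (y l) := by
          rw [← Finset.prod_sdiff hsub, hM]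
          simp [Polynomial.eval_prod]
          ring
        rw [h1, hev]; ring
      have hcN : c ∉ N c := fun h => lt_irrefl _ (hG.lt c hcV c h)
      have hfil : V.filter (fun l => c ≤ l) = insert c (V.filter (fun l => c + 1 ≤ l)) := by
        ext l
        simp only [Finset.mem_filter, Finset.mem_insert]
        constructor
        · rintro ⟨h1, h2⟩
          rcases Nat.eq_or_lt_of_le h2 with h | h
          · exact Or.inl h.symm
          · exact Or.inr ⟨h1, h⟩
        · rintro (h | ⟨h1, h2⟩)
          · subst h; exact ⟨hcV, le_rfl⟩
          · exact ⟨h1, by omega⟩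
      have hih := ih (c + 1) (by omega) (by omega) (insert c (N c)) (by
        intro j' hj' hcj k hk hkc
        rcases Nat.lt_succ_iff_lt_or_eq.mp hkc with h | h
        · exact Finset.mem_insert_of_mem (hG.sw c hcV j' hj' (by omega) k hk h)
        · subst h; exact Finset.mem_insert_self _ _) R
      have : ∑ l ∈ V.filter (fun l => c ≤ l), (∏ k ∈ T, (y l - y k)) * Q.eval (y l)
          = M.eval (y c) * Fj y V N c +
            ∑ l ∈ V.filter (fun l => c + 1 ≤ l),
              (∏ k ∈ insert c (N c), (y l - y k)) * R.eval (y l) := by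
        rw [Finset.sum_congr rfl (fun l _ => hprod l), Finset.sum_add_distrib, ← Finset.mul_sum]
        congr 1
        rw [hfil, Finset.sum_insert (by simp)]
        simp only [sub_self, zero_mul, mul_zero, zero_add]
        refine Finset.sum_congr rfl fun l _ => ?_
        rw [Finset.prod_insert hcN]; ring
      rw [this]
      exact add_mem (Ideal.mul_mem_left _ _ (Fj_mem_JJ hcV)) hih
    · have hfil : V.filter (fun l => c ≤ l) = V.filter (fun l => c + 1 ≤ l) := by
        apply Finset.filter_congr
        intro l hl
        have : l ≠ c := fun h => hcV (h ▸ hl)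
        omega
      rw [hfil]
      refine ih (c + 1) (by omega) (by omega) T ?_ Q
      intro j' hj' hcj k hk hkc
      have hkc' : k ≠ c := by
        rintro rfl
        rcases hG.mem j' hj' k hk with h | h
        · omega
        · exact hcV h
      exact hT j' hj' (by omega) k hk (by omega)

/-- Deletion of the hyperplane `(0, j)`. -/
def Ndel (N : ℕ → Finset ℕ) (j : ℕ) : ℕ → Finset ℕ := fun l => if l = j then (N j).erase 0 else N l

/-- Restriction to the hyperplane `(0, j)`. -/
def Nres (N : ℕ → Finset ℕ) (j : ℕ) : ℕ → Finset ℕ :=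
  fun l => if j ∈ N l then insert 0 ((N l).erase j) else N l

lemma good_del {V N} (hG : Good V N) {j : ℕ} (hj : j ∈ V) (hmax : ∀ l ∈ V, 0 ∈ N l → l ≤ j) :
    Good V (Ndel N j) := by
  have hsub : ∀ l, ∀ k ∈ Ndel N j l, k ∈ N l := by
    intro l k hk
    unfold Ndel at hk
    split_ifs at hk with h
    · subst h; exact Finset.mem_of_mem_erase hk
    · exact hk
  refine ⟨hG.zero, fun l hl k hk => hG.lt l hl k (hsub l k hk),
    fun l hl k hk => hG.mem l hl k (hsub l k hk), ?_⟩
  intro l hl l' hl' hll k hk hkl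
  have h1 := hG.sw l hl l' hl' hll k (hsub _ _ hk) hkl
  by_cases h : l = j
  · have hk0 : k ≠ 0 := by
      rintro rfl
      have := hmax l' hl' (hsub _ _ hk)
      omega
    simp [Ndel, h] at h1 ⊢
    exact ⟨hk0, h1⟩
  · simpa [Ndel, h] using h1

lemma card_del {N : ℕ → Finset ℕ} {j : ℕ} (h0 : 0 ∈ N j) :
    (Ndel N j j).card + 1 = (N j).card := by
  simp [Ndel, Finset.card_erase_add_one h0]

lemma card_del_ne {N : ℕ → Finset ℕ} {j l : ℕ} (h : l ≠ j) : Ndel N j l = N l := by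
  simp [Ndel, h]

lemma card_res {V N} (hG : Good V N) {j : ℕ} (hmax : ∀ l ∈ V, 0 ∈ N l → l ≤ j)
    {l : ℕ} (hl : l ∈ V) : (Nres N j l).card = (N l).card := by
  unfold Nres
  split_ifs with h
  · have h1 := hG.lt l hl j h
    have h0 : 0 ∉ N l := fun h' => by have := hmax l hl h'; omega
    rw [Finset.card_insert_of_notMem (fun h' => h0 (Finset.mem_of_mem_erase h')),
      Finset.card_erase_add_one h]
  · rfl

lemma good_res {V N} (hG : Good V N) {j : ℕ} (hj : j ∈ V) (h0 : 0 ∈ N j) :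
    Good (V.erase j) (Nres N j) := by
  have hsub : ∀ l, ∀ k ∈ Nres N j l, k ≠ 0 → k ∈ N l ∧ k ≠ j := by
    intro l k hk hk0
    unfold Nres at hk
    split_ifs at hk with h
    · simp [hk0] at hk
      exact ⟨hk.2, hk.1⟩
    · exact ⟨hk, fun h' => h (h' ▸ hk)⟩
  have hpos : ∀ l ∈ V, 0 < l := fun l hl => Nat.pos_of_ne_zero fun h => hG.zero (h ▸ hl)
  refine ⟨fun h => hG.zero (Finset.mem_of_mem_erase h), ?_, ?_, ?_⟩
  · intro l hl k hk
    have hl' := Finset.mem_of_mem_erase hl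
    by_cases hk0 : k = 0
    · subst hk0; exact hpos l hl'
    · exact hG.lt l hl' k (hsub l k hk hk0).1
  · intro l hl k hk
    have hl' := Finset.mem_of_mem_erase hl
    by_cases hk0 : k = 0
    · exact Or.inl hk0
    · have h1 := hsub l k hk hk0
      rcases hG.mem l hl' k h1.1 with h | h
      · exact Or.inl h
      · exact Or.inr (Finset.mem_erase.mpr ⟨h1.2, h⟩)
  · intro l hl l' hl' hll k hk hkl
    obtain ⟨hlj, hl⟩ := Finset.mem_erase.mp hl
    obtain ⟨hlj', hl'⟩ := Finset.mem_erase.mp hl'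
    by_cases hk0 : k = 0
    · subst hk0
      have key : j ∈ N l ∨ 0 ∈ N l := by
        by_cases hj' : j ∈ N l'
        · rcases lt_or_gt_of_ne hlj with h | h
          · exact Or.inr (hG.sw l hl j hj h 0 h0 (hpos l hl))
          · exact Or.inl (hG.sw l hl l' hl' hll j hj' h)
        · simp [Nres, hj'] at hk
          exact Or.inr (hG.sw l hl l' hl' hll 0 hk (hpos l hl))
      unfold Nres
      split_ifs with h
      · simp
      · exact key.resolve_left h
    · have h1 := hsub l' k hk hk0
      have h2 := hG.sw l hl l' hl' hll k h1.1 hkl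
      unfold Nres
      split_ifs with h
      · simp [h1.2, h2]
      · exact h2

lemma res_le (y : ℕ → S) (hy0 : y 0 = 0) {V N} (hG : Good V N) {j : ℕ} (hj : j ∈ V)
    (h0 : 0 ∈ N j) (hmax : ∀ l ∈ V, 0 ∈ N l → l ≤ j) :
    JJ y (V.erase j) (Nres N j) ≤ JJ y V N ⊔ Ideal.span {y j} := by
  set I := JJ y V N ⊔ Ideal.span {y j} with hI
  have hyj : y j ∈ I := Ideal.mem_sup_right (Ideal.mem_span_singleton_self _)
  refine Ideal.span_le.mpr ?_
  rintro s (⟨i, hi, rfl⟩ | ⟨l, hl, rfl⟩)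
  · by_cases hij : i = j
    · subst hij; exact hyj
    · exact Ideal.mem_sup_left (y_mem_JJ fun h => hi (Finset.mem_erase.mpr ⟨hij, h⟩))
  · obtain ⟨hlj, hl⟩ := Finset.mem_erase.mp hl
    have hF : Fj y V N l ∈ I := Ideal.mem_sup_left (Fj_mem_JJ hl)
    have hprod : ∀ i, ∏ k ∈ Nres N j l, (y i - y k) - ∏ k ∈ N l, (y i - y k) ∈ I := by
      intro i
      unfold Nres
      split_ifs with h
      · have h1 := hG.lt l hl j h
        have h0' : 0 ∉ N l := fun h' => by have := hmax l hl h'; omega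
        rw [Finset.prod_insert (fun h' => h0' (Finset.mem_of_mem_erase h')),
          ← Finset.mul_prod_erase _ _ h, ← sub_mul, hy0]
        exact Ideal.mul_mem_right _ _ (by simpa using hyj)
      · simp
    have hextra : j ∈ V.filter (fun i => l ≤ i) → ∏ k ∈ N l, (y j - y k) ∈ I := by
      intro h
      have hlj' : l < j := lt_of_le_of_ne (Finset.mem_filter.mp h).2 hlj
      have h0l : 0 ∈ N l := hG.sw l hl j hj hlj' 0 h0
        (Nat.pos_of_ne_zero fun h => hG.zero (h ▸ hl))
      rw [← Finset.mul_prod_erase _ _ h0l, hy0]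
      exact Ideal.mul_mem_right _ _ (by simpa using hyj)
    have hsum : ∑ i ∈ (V.erase j).filter (fun i => l ≤ i), ∏ k ∈ N l, (y i - y k) ∈ I := by
      rw [Finset.filter_erase]
      by_cases h : j ∈ V.filter (fun i => l ≤ i)
      · have := Finset.add_sum_erase _ (fun i => ∏ k ∈ N l, (y i - y k)) h
        have h2 : Fj y V N l - ∏ k ∈ N l, (y j - y k) ∈ I := sub_mem hF (hextra h)
        rw [Fj, ← this] at h2
        simpa using h2
      · rw [Finset.erase_eq_of_notMem h]
        exact hF
    have hdiff : Fj y (V.erase j) (Nres N j) l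
        - ∑ i ∈ (V.erase j).filter (fun i => l ≤ i), ∏ k ∈ N l, (y i - y k) ∈ I := by
      rw [Fj, ← Finset.sum_sub_distrib]
      exact Ideal.sum_mem _ fun i _ => hprod i
    simpa using add_mem hdiff hsum

lemma del_mul (y : ℕ → S) (hy0 : y 0 = 0) {V N} (hG : Good V N) {j : ℕ} (hj : j ∈ V)
    (h0 : 0 ∈ N j) (hmax : ∀ l ∈ V, 0 ∈ N l → l ≤ j) {u : S} (hu : u ∈ JJ y V (Ndel N j)) :
    y j * u ∈ JJ y V N := by
  suffices h : JJ y V (Ndel N j) ≤ Submodule.comap (LinearMap.mulLeft S (y j)) (JJ y V N) from h hu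
  refine Ideal.span_le.mpr ?_
  rintro s (⟨i, hi, rfl⟩ | ⟨l, hl, rfl⟩)
  · exact Ideal.mul_mem_left _ _ (y_mem_JJ hi)
  · by_cases hlj : l = j
    · subst hlj
      change y l * Fj y V (Ndel N l) l ∈ JJ y V N
      have hpos : 0 < l := Nat.pos_of_ne_zero fun h => hG.zero (h ▸ hj)
      have hlN : l ∉ N l := fun h => lt_irrefl _ (hG.lt l hj l h)
      obtain ⟨m, hm⟩ : ∃ m, ∀ i ∈ V, i < m :=
        ⟨V.sup id + 1, fun i hi => Nat.lt_succ_of_le (Finset.le_sup (f := id) hi)⟩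
      have ht := tail_mem y hG m hm m (l + 1) (by omega) (by omega)
        (insert l ((N l).erase 0)) (by
          intro j' hj' hlj' k hk hkl
          rcases Nat.lt_succ_iff_lt_or_eq.mp hkl with h | h
          · have hk0 : k ≠ 0 := by
              rintro rfl
              have := hmax j' hj' hk
              omega
            exact Finset.mem_insert_of_mem
              (Finset.mem_erase.mpr ⟨hk0, hG.sw l hj j' hj' (by omega) k hk h⟩)
          · subst h; exact Finset.mem_insert_self _ _) 1
      have hfil : V.filter (fun i => l ≤ i) = insert l (V.filter (fun i => l + 1 ≤ i)) := by
        ext i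
        simp only [Finset.mem_filter, Finset.mem_insert]
        constructor
        · rintro ⟨h1, h2⟩
          rcases Nat.eq_or_lt_of_le h2 with h | h
          · exact Or.inl h.symm
          · exact Or.inr ⟨h1, h⟩
        · rintro (h | ⟨h1, h2⟩)
          · subst h; exact ⟨hj, le_rfl⟩
          · exact ⟨h1, by omega⟩
      have key : y l * Fj y V (Ndel N l) l = Fj y V N l -
          ∑ i ∈ V.filter (fun i => l + 1 ≤ i),
            (∏ k ∈ insert l ((N l).erase 0), (y i - y k)) * (1 : Polynomial S).eval (y i) := by
        have e1 : ∑ i ∈ V.filter (fun i => l + 1 ≤ i),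
            (∏ k ∈ insert l ((N l).erase 0), (y i - y k)) * (1 : Polynomial S).eval (y i)
            = ∑ i ∈ V.filter (fun i => l ≤ i), (y i - y l) * ∏ k ∈ (N l).erase 0, (y i - y k) := by
          rw [hfil, Finset.sum_insert (by simp)]
          simp only [sub_self, zero_mul, zero_add, Polynomial.eval_one, mul_one]
          refine Finset.sum_congr rfl fun i _ => ?_
          rw [Finset.prod_insert fun h => hlN (Finset.mem_of_mem_erase h)]
        rw [e1, Fj, Fj, Finset.mul_sum, ← Finset.sum_sub_distrib]
        refine Finset.sum_congr rfl fun i _ => ?_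
        rw [← Finset.mul_prod_erase _ _ h0, hy0]
        simp only [Ndel, if_true]
        ring
      rw [key]
      exact sub_mem (Fj_mem_JJ hj) ht
    · change y j * Fj y V (Ndel N j) l ∈ JJ y V N
      have : Fj y V (Ndel N j) l = Fj y V N l := by simp [Fj, Ndel, hlj]
      rw [this]
      exact Ideal.mul_mem_left _ _ (Fj_mem_JJ hl)

lemma spanning [CharZero K] (y : ℕ → S) (hy0 : y 0 = 0)
    (hgen : Algebra.adjoin K (Set.range y) = ⊤) (d : ℕ) :
    ∀ (V : Finset ℕ) (N : ℕ → Finset ℕ), Good V N → V.card + ∑ l ∈ V, (N l).card ≤ d →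
      ∀ g : S, ∃ u ∈ Submodule.span K (Mon y V N), g - u ∈ JJ y V N := by
  induction d using Nat.strong_induction_on with
  | _ d ih =>
  intro V N hG hd g
  by_cases hex : ∃ l ∈ V, 0 ∈ N l
  · obtain ⟨j, hj, hmax⟩ := Finset.exists_max_image (V.filter fun l => 0 ∈ N l) id
      (by obtain ⟨l, hl, h⟩ := hex; exact ⟨l, Finset.mem_filter.mpr ⟨hl, h⟩⟩)
    obtain ⟨hj, h0⟩ := Finset.mem_filter.mp hj
    replace hmax : ∀ l ∈ V, 0 ∈ N l → l ≤ j := fun l hl h =>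
      hmax l (Finset.mem_filter.mpr ⟨hl, h⟩)
    have hcV : (V.erase j).card + 1 = V.card := Finset.card_erase_add_one hj
    have hsumV : ∀ F : ℕ → ℕ, F j + ∑ l ∈ V.erase j, F l = ∑ l ∈ V, F l :=
      fun F => Finset.add_sum_erase _ F hj
    have hpos : 0 < d := by omega
    obtain ⟨u, hu, hgu⟩ := ih (d - 1) (by omega) (V.erase j) (Nres N j) (good_res hG hj h0) (by
      have h1 : ∑ l ∈ V.erase j, (Nres N j l).card = ∑ l ∈ V.erase j, (N l).card :=
        Finset.sum_congr rfl fun l hl => card_res hG hmax (Finset.mem_of_mem_erase hl)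
      have := hsumV fun l => (N l).card
      omega) g
    obtain ⟨v, hv, w, hw, hvw⟩ := Submodule.mem_sup.mp (res_le y hy0 hG hj h0 hmax hgu)
    obtain ⟨r, rfl⟩ := Ideal.mem_span_singleton'.mp hw
    obtain ⟨u', hu', hru⟩ := ih (d - 1) (by omega) V (Ndel N j) (good_del hG hj hmax) (by
      have h1 : ∑ l ∈ V.erase j, (Ndel N j l).card = ∑ l ∈ V.erase j, (N l).card :=
        Finset.sum_congr rfl fun l hl => by rw [card_del_ne (Finset.mem_erase.mp hl).1]
      have h2 := hsumV fun l => (N l).card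
      have h3 := hsumV fun l => (Ndel N j l).card
      have h4 := card_del h0
      omega) r
    refine ⟨u + y j * u', add_mem ?_ ?_, ?_⟩
    · refine Submodule.span_mono ?_ hu
      rintro s ⟨a, ha, rfl⟩
      refine ⟨Function.update a j 0, ?_, ?_⟩
      · intro i hi
        by_cases hij : i = j
        · subst hij
          simpa using Finset.card_pos.mpr ⟨0, h0⟩
        · rw [Function.update_of_ne hij, ← card_res hG hmax hi]
          exact ha i (Finset.mem_erase.mpr ⟨hij, hi⟩)
      · rw [← Finset.mul_prod_erase _ _ hj]
        simp only [Function.update_self, pow_zero, one_mul]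
        exact Finset.prod_congr rfl fun i hi => by
          rw [Function.update_of_ne (Finset.mem_erase.mp hi).1]
    · have : Submodule.span K (Mon y V (Ndel N j)) ≤
          (Submodule.span K (Mon y V N)).comap (LinearMap.mulLeft K (y j)) := by
        refine Submodule.span_le.mpr ?_
        rintro s ⟨a, ha, rfl⟩
        refine Submodule.subset_span ⟨Function.update a j (a j + 1), ?_, ?_⟩
        · intro i hi
          have h1 := ha i hi
          by_cases hij : i = j
          · subst hij
            have := card_del h0
            simp only [Function.update_self]
            omega
          · rw [Function.update_of_ne hij]
            rwa [card_del_ne hij] at h1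
        · rw [LinearMap.mulLeft_apply, ← Finset.mul_prod_erase _ _ hj,
            ← Finset.mul_prod_erase V (fun i => y i ^ (Function.update a j (a j + 1)) i) hj]
          simp only [Function.update_self, pow_succ']
          rw [mul_assoc]
          congr 2
          exact Finset.prod_congr rfl fun i hi => by
            rw [Function.update_of_ne (Finset.mem_erase.mp hi).1]
      exact this hu'
    · have e : g - (u + y j * u') = v + y j * (r - u') := by
        linear_combination -hvw
      rw [e]
      exact add_mem hv (del_mul y hy0 hG hj h0 hmax hru)
  · push Not at hex
    by_cases hV : V.Nonempty
    · obtain ⟨c, hc, hmin⟩ := Finset.exists_min_image V id hV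
      have hN : N c = ∅ := by
        refine Finset.eq_empty_of_forall_notMem fun k hk => ?_
        rcases hG.mem c hc k hk with h | h
        · subst h; exact hex c hc hk
        · have h1 := hmin k h
          have h2 := hG.lt c hc k hk
          simp only [id] at h1
          omega
      have hF : Fj y V N c = algebraMap K S (V.card : K) := by
        rw [Fj, hN, Finset.filter_true_of_mem (p := fun l => c ≤ l) (fun l hl => hmin l hl)]
        simp
      refine ⟨0, zero_mem _, ?_⟩
      have hne : (V.card : K) ≠ 0 := by
        exact_mod_cast (Finset.card_pos.mpr hV).ne'
      have h1 : algebraMap K S ((V.card : K)⁻¹) * Fj y V N c = 1 := by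
        rw [hF, ← map_mul, inv_mul_cancel₀ hne, map_one]
      have h2 : (1 : S) ∈ JJ y V N := h1 ▸ Ideal.mul_mem_left _ _ (Fj_mem_JJ hc)
      rw [(Ideal.eq_top_iff_one _).mpr h2]
      trivial
    · rw [Finset.not_nonempty_iff_eq_empty] at hV
      subst hV
      have hg : g ∈ Algebra.adjoin K (Set.range y) := hgen ▸ Algebra.mem_top
      have hone : ∀ k : K, algebraMap K S k ∈ Submodule.span K (Mon y ∅ N) := by
        intro k
        rw [Algebra.algebraMap_eq_smul_one]
        exact Submodule.smul_mem _ _ (Submodule.subset_span ⟨0, by simp, by simp⟩)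
      suffices h : ∃ k : K, g - algebraMap K S k ∈ JJ y ∅ N by
        obtain ⟨k, hk⟩ := h
        exact ⟨_, hone k, hk⟩
      induction hg using Algebra.adjoin_induction with
      | mem x hx =>
        obtain ⟨i, rfl⟩ := hx
        exact ⟨0, by simpa using y_mem_JJ (by simp)⟩
      | algebraMap r => exact ⟨r, by simp⟩
      | add a b _ _ ha hb =>
        obtain ⟨k, hk⟩ := ha
        obtain ⟨k', hk'⟩ := hb
        refine ⟨k + k', ?_⟩
        have := add_mem hk hk'
        rw [map_add]
        convert this using 1
        ring
      | mul a b _ _ ha hb =>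
        obtain ⟨k, hk⟩ := ha
        obtain ⟨k', hk'⟩ := hb
        refine ⟨k * k', ?_⟩
        have := add_mem (Ideal.mul_mem_right b _ hk) (Ideal.mul_mem_left _ (algebraMap K S k) hk')
        rw [map_mul]
        convert this using 1
        ring

end Span

section Indep

variable {K : Type*} [Field K] {n : ℕ}

/-- The elements `x^(c mod h) f^(c div h)`. -/
def ee (h : Fin n → ℕ) (f : Fin n → MvPolynomial (Fin n) K) (c : Fin n →₀ ℕ) :
    MvPolynomial (Fin n) K :=
  ∏ i, (X i ^ (c i % h i) * f i ^ (c i / h i))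

/-- The linear endomorphism sending `x^c` to `ee h f c`. -/
def phi (h : Fin n → ℕ) (f : Fin n → MvPolynomial (Fin n) K) :
    MvPolynomial (Fin n) K →ₗ[K] MvPolynomial (Fin n) K :=
  (basisMonomials (Fin n) K).constr K (ee h f)

lemma phi_monomial (h : Fin n → ℕ) (f : Fin n → MvPolynomial (Fin n) K) (c : Fin n →₀ ℕ) :
    phi h f (monomial c 1) = ee h f c := by
  have := (basisMonomials (Fin n) K).constr_basis K (ee h f) c
  simpa [phi] using this

lemma ee_hom {h : Fin n → ℕ} {f : Fin n → MvPolynomial (Fin n) K}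
    (hf : ∀ i, (f i).IsHomogeneous (h i)) (c : Fin n →₀ ℕ) :
    (ee h f c).IsHomogeneous c.degree := by
  have : c.degree = ∑ i, (c i % h i + h i * (c i / h i)) := by
    rw [Finsupp.degree_eq_sum]
    exact Finset.sum_congr rfl fun i _ => (Nat.mod_add_div _ _).symm
  rw [this]
  exact IsHomogeneous.prod _ _ _ fun i _ => (isHomogeneous_X_pow i _).mul ((hf i).pow _)

lemma phi_mul {h : Fin n → ℕ} (hpos : ∀ i, 0 < h i) (f : Fin n → MvPolynomial (Fin n) K)
    (p : MvPolynomial (Fin n) K) (i : Fin n) :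
    phi h f (p * X i ^ h i) = phi h f p * f i := by
  have key : (phi h f) ∘ₗ (LinearMap.mulRight K (X i ^ h i)) =
      (LinearMap.mulRight K (f i)) ∘ₗ phi h f := by
    refine (basisMonomials (Fin n) K).ext fun c => ?_
    simp only [coe_basisMonomials, LinearMap.comp_apply, LinearMap.mulRight_apply]
    rw [X_pow_eq_monomial, monomial_mul, one_mul, phi_monomial, phi_monomial, ee, ee,
      ← Finset.mul_prod_erase _ _ (Finset.mem_univ i),
      ← Finset.mul_prod_erase Finset.univ (fun j => X j ^ (c j % h j) * f j ^ (c j / h j))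
        (Finset.mem_univ i)]
    have h1 : ∀ j ∈ Finset.univ.erase i, (c + Finsupp.single i (h i)) j = c j := by
      intro j hj
      have : i ≠ j := (Finset.mem_erase.mp hj).1.symm
      simp [this]
    rw [Finset.prod_congr rfl (fun j hj => by rw [h1 j hj])]
    simp only [Finsupp.add_apply, Finsupp.single_eq_same, Nat.add_mod_right,
      Nat.add_div_right _ (hpos i), pow_succ]
    ring
  exact LinearMap.congr_fun key p

lemma phi_comp {h : Fin n → ℕ} {f : Fin n → MvPolynomial (Fin n) K}
    (hf : ∀ i, (f i).IsHomogeneous (h i)) (d : ℕ) (p : MvPolynomial (Fin n) K) :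
    homogeneousComponent d (phi h f p) = phi h f (homogeneousComponent d p) := by
  have key : (homogeneousComponent d) ∘ₗ phi h f = phi h f ∘ₗ (homogeneousComponent d) := by
    refine (basisMonomials (Fin n) K).ext fun c => ?_
    simp only [coe_basisMonomials, LinearMap.comp_apply]
    rw [phi_monomial, homogeneousComponent_of_mem (ee_hom hf c),
      homogeneousComponent_of_mem (isHomogeneous_monomial (1 : K) (rfl : c.degree = c.degree))]
    split_ifs
    · rw [phi_monomial]
    · simp
  exact LinearMap.congr_fun key p

/-- The reduced monomials. -/
def Red (K : Type*) [Field K] (h : Fin n → ℕ) : Set (MvPolynomial (Fin n) K) :=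
  {s | ∃ c : Fin n →₀ ℕ, (∀ i, c i < h i) ∧ s = monomial c 1}

lemma phi_red {h : Fin n → ℕ} (f : Fin n → MvPolynomial (Fin n) K) {u : MvPolynomial (Fin n) K}
    (hu : u ∈ Submodule.span K (Red K h)) : phi h f u = u := by
  have : Submodule.span K (Red K h) ≤ LinearMap.eqLocus (phi h f) LinearMap.id := by
    refine Submodule.span_le.mpr ?_
    rintro s ⟨c, hc, rfl⟩
    change phi h f _ = _
    rw [phi_monomial, ee, LinearMap.id_apply, monomial_eq, Finsupp.prod_fintype _ _ (by simp)]
    simp only [map_one, one_mul]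
    exact Finset.prod_congr rfl fun i _ => by
      rw [Nat.mod_eq_of_lt (hc i), Nat.div_eq_of_lt (hc i)]; simp
  exact this hu

lemma comp_mul {g f : MvPolynomial (Fin n) K} {e : ℕ} (hf : f.IsHomogeneous e) (d : ℕ) :
    homogeneousComponent d (g * f) =
      if e ≤ d then homogeneousComponent (d - e) g * f else 0 := by
  conv_lhs => rw [← sum_homogeneousComponent g]
  rw [Finset.sum_mul, map_sum]
  have h1 : ∀ k, homogeneousComponent d (homogeneousComponent k g * f) =
      if k + e = d then homogeneousComponent k g * f else 0 := by
    intro k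
    rw [homogeneousComponent_of_mem ((homogeneousComponent_isHomogeneous k g).mul hf)]
    simp only [eq_comm]
  simp only [h1]
  split_ifs with hed
  · rw [Finset.sum_eq_single (d - e)]
    · rw [if_pos (by omega)]
    · intro k _ hk
      rw [if_neg (by omega)]
    · intro hk
      rw [if_pos (by omega), homogeneousComponent_eq_zero, zero_mul]
      simp at hk
      omega
  · refine Finset.sum_eq_zero fun k _ => if_neg (by omega)

lemma phi_surj {h : Fin n → ℕ} (hpos : ∀ i, 0 < h i) {f : Fin n → MvPolynomial (Fin n) K}
    (hf : ∀ i, (f i).IsHomogeneous (h i))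
    (hspan : ∀ g, ∃ u ∈ Submodule.span K (Red K h), g - u ∈ Ideal.span (Set.range f)) (d : ℕ) :
    ∀ p : MvPolynomial (Fin n) K, p.IsHomogeneous d →
      ∃ q : MvPolynomial (Fin n) K, q.IsHomogeneous d ∧ phi h f q = p := by
  induction d using Nat.strong_induction_on with
  | _ d ih =>
  intro p hp
  obtain ⟨u, hu, hpu⟩ := hspan p
  obtain ⟨g, hg⟩ := Ideal.mem_span_range_iff_exists_fun.mp hpu
  have hterm : ∀ i, ∃ q : MvPolynomial (Fin n) K, q.IsHomogeneous d ∧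
      phi h f q = homogeneousComponent d (g i * f i) := by
    intro i
    rw [comp_mul (hf i)]
    split_ifs with hi
    · obtain ⟨q, hq, hq'⟩ := ih (d - h i) (by have := hpos i; omega) _
        (homogeneousComponent_isHomogeneous (d - h i) (g i))
      refine ⟨q * X i ^ h i, ?_, ?_⟩
      · have := hq.mul (isHomogeneous_X_pow (R := K) i (h i))
        rwa [Nat.sub_add_cancel hi] at this
      · rw [phi_mul hpos, hq']
    · exact ⟨0, isHomogeneous_zero _ _ _, by simp⟩
  choose q hq hq' using hterm
  refine ⟨homogeneousComponent d u + ∑ i, q i,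
    (homogeneousComponent_isHomogeneous d u).add (IsHomogeneous.sum _ _ _ fun i _ => hq i), ?_⟩
  rw [map_add, map_sum, ← phi_comp hf, phi_red f hu]
  simp only [hq']
  rw [← map_sum, hg, ← map_add, add_sub_cancel, homogeneousComponent_eq_self hp]

lemma phi_inj {h : Fin n → ℕ} (hpos : ∀ i, 0 < h i) {f : Fin n → MvPolynomial (Fin n) K}
    (hf : ∀ i, (f i).IsHomogeneous (h i))
    (hspan : ∀ g, ∃ u ∈ Submodule.span K (Red K h), g - u ∈ Ideal.span (Set.range f))
    (p : MvPolynomial (Fin n) K) (hp : phi h f p = 0) : p = 0 := by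
  rw [← sum_homogeneousComponent p]
  refine Finset.sum_eq_zero fun d _ => ?_
  have h0 : phi h f (homogeneousComponent d p) = 0 := by rw [← phi_comp hf, hp, map_zero]
  have hmap : ∀ q ∈ homogeneousSubmodule (Fin n) K d, phi h f q ∈ homogeneousSubmodule (Fin n) K d := by
    intro q hq
    have := phi_comp hf d q
    rw [homogeneousComponent_eq_self hq] at this
    rw [← this]
    exact homogeneousComponent_isHomogeneous _ _
  have : Module.Finite K (homogeneousSubmodule (Fin n) K d) :=
    Module.Finite.iff_fg.mpr (homogeneousSubmodule_fg (Fin n) K d)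
  have hs : Function.Surjective ((phi h f).restrict hmap) := by
    rintro ⟨p, hp⟩
    obtain ⟨q, hq, hq'⟩ := phi_surj hpos hf hspan d p hp
    exact ⟨⟨q, hq⟩, Subtype.ext hq'⟩
  have hi := LinearMap.injective_iff_surjective.mpr hs
  have := @hi ⟨_, homogeneousComponent_isHomogeneous d p⟩ 0 (Subtype.ext (by simpa using h0))
  exact congrArg Subtype.val this

lemma red_zero {h : Fin n → ℕ} (hpos : ∀ i, 0 < h i) {f : Fin n → MvPolynomial (Fin n) K}
    (hf : ∀ i, (f i).IsHomogeneous (h i))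
    (hspan : ∀ g, ∃ u ∈ Submodule.span K (Red K h), g - u ∈ Ideal.span (Set.range f))
    {u : MvPolynomial (Fin n) K} (hu : u ∈ Submodule.span K (Red K h))
    (huI : u ∈ Ideal.span (Set.range f)) : u = 0 := by
  obtain ⟨g, hg⟩ := Ideal.mem_span_range_iff_exists_fun.mp huI
  have hsurj : ∀ p, ∃ q, phi h f q = p := by
    intro p
    choose q hq hq' using fun d => phi_surj hpos hf hspan d _ (homogeneousComponent_isHomogeneous d p)
    refine ⟨∑ d ∈ Finset.range (p.totalDegree + 1), q d, ?_⟩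
    rw [map_sum]
    simp only [hq']
    exact sum_homogeneousComponent p
  choose q hq using fun i => hsurj (g i)
  have h1 : u - ∑ i, q i * X i ^ h i = 0 := by
    apply phi_inj hpos hf hspan
    rw [map_sub, phi_red f hu, map_sum]
    simp only [phi_mul hpos, hq, hg, sub_self]
  have hsupp : ∀ c ∈ u.support, ∀ i, c i < h i := by
    have : Submodule.span K (Red K h) ≤ restrictSupport K {c | ∀ i, c i < h i} := by
      refine Submodule.span_le.mpr ?_
      rintro s ⟨c, hc, rfl⟩
      rw [SetLike.mem_coe, mem_restrictSupport_iff]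
      intro c' hc'
      have := support_monomial_subset hc'
      simp at this
      subst this
      exact hc
    intro c hc
    exact (mem_restrictSupport_iff K).mp (this hu) hc
  ext c
  rw [coeff_zero]
  by_contra hc
  have hcs := hsupp c (mem_support_iff.mpr hc)
  apply hc
  rw [sub_eq_zero.mp h1, coeff_sum]
  refine Finset.sum_eq_zero fun i _ => ?_
  rw [X_pow_eq_monomial, coeff_mul_monomial', if_neg]
  intro hle
  have := hle i
  have := hcs i
  simp at *
  omega

end Indep

section Der

variable (K : Type*) [Field K] (n : ℕ)

/-- The variables indexed by natural numbers, with `yy 0 = 0`. -/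
def yy (i : ℕ) : MvPolynomial (Fin n) K :=
  if h : 0 < i ∧ i ≤ n then X ⟨i - 1, by omega⟩ else 0

lemma yy_zero : yy K n 0 = 0 := by simp [yy]

lemma yy_succ (i : Fin n) : yy K n (i + 1) = X i := by
  have := i.isLt
  simp [yy, Nat.succ_le_of_lt this]

lemma yy_cases (i : ℕ) (hi : i ≤ n) : i = 0 ∨ ∃ j : Fin n, i = j + 1 := by
  rcases i with _ | i
  · exact Or.inl rfl
  · exact Or.inr ⟨⟨i, by omega⟩, rfl⟩

lemma varx_eq (i : Fin (n + 1)) : varx K n i = yy K n i := by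
  have := i.isLt
  unfold varx yy
  by_cases h : (i : ℕ) = 0
  · simp [h]
  · have h' : 0 < (i : ℕ) ∧ (i : ℕ) ≤ n := by omega
    rw [dif_neg h, dif_pos h']

lemma yy_inj {i j : ℕ} (hi : i ≤ n) (hj : j ≤ n) (h : yy K n i = yy K n j) : i = j := by
  rcases yy_cases n i hi with rfl | ⟨i, rfl⟩ <;> rcases yy_cases n j hj with rfl | ⟨j, rfl⟩
  · rfl
  · rw [yy_zero, yy_succ] at h
    exact absurd h.symm (X_ne_zero j)
  · rw [yy_zero, yy_succ] at h
    exact absurd h (X_ne_zero i)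
  · rw [yy_succ, yy_succ] at h
    rw [X_injective h]

/-- Substitution of `yy k` for `yy l`. -/
def sub (k l : ℕ) : MvPolynomial (Fin n) K →ₐ[K] MvPolynomial (Fin n) K :=
  aeval fun i => if (i : ℕ) + 1 = l then yy K n k else X i

lemma sub_yy (k : ℕ) {l m : ℕ} (hl : 0 < l) (hm : m ≤ n) :
    sub K n k l (yy K n m) = yy K n (if m = l then k else m) := by
  rcases yy_cases n m hm with rfl | ⟨i, rfl⟩
  · rw [if_neg (by omega), yy_zero, map_zero]
  · rw [yy_succ, sub, aeval_X]
    split_ifs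
    · rfl
    · rw [yy_succ]

lemma dvd_iff_sub {k l : ℕ} (hkl : k < l) (hl : l ≤ n) (g : MvPolynomial (Fin n) K) :
    (yy K n l - yy K n k) ∣ g ↔ sub K n k l g = 0 := by
  constructor
  · rintro ⟨r, rfl⟩
    rw [map_mul, map_sub, sub_yy K n k (by omega) hl, sub_yy K n k (by omega) (by omega),
      if_pos rfl, if_neg (by omega), _root_.sub_self, zero_mul]
  · intro h
    set I := Ideal.span {yy K n l - yy K n k} with hI
    have key : (Ideal.Quotient.mkₐ K I).comp (sub K n k l) = Ideal.Quotient.mkₐ K I := by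
      refine MvPolynomial.algHom_ext fun i => ?_
      rw [AlgHom.comp_apply, ← yy_succ, sub_yy K n k (by omega) i.isLt]
      split_ifs with hi
      · rw [Ideal.Quotient.mkₐ_eq_mk, Ideal.Quotient.eq, show (i : ℕ) + 1 = l from hi, ← neg_sub, neg_mem_iff]
        exact Ideal.mem_span_singleton_self _
      · rfl
    have := AlgHom.congr_fun key g
    rw [AlgHom.comp_apply, h, map_zero] at this
    exact Ideal.mem_span_singleton.mp (Ideal.Quotient.eq_zero_iff_mem.mp this.symm)

lemma prime_lin {k l : ℕ} (hkl : k < l) (hl : l ≤ n) : Prime (yy K n l - yy K n k) := by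
  refine ⟨?_, ?_, ?_⟩
  · intro h
    have := yy_inj K n hl (by omega) (sub_eq_zero.mp h)
    omega
  · intro h
    have h1 := (dvd_iff_sub K n hkl hl 1).mp h.dvd
    rw [map_one] at h1
    exact one_ne_zero h1
  · intro a b hab
    rw [dvd_iff_sub K n hkl hl, map_mul, mul_eq_zero] at hab
    rwa [dvd_iff_sub K n hkl hl, dvd_iff_sub K n hkl hl]

lemma not_dvd_lin {k l k' l' : ℕ} (hkl : k < l) (hl : l ≤ n) (hkl' : k' < l') (hl' : l' ≤ n)
    (hne : ¬ (k = k' ∧ l = l')) : ¬ (yy K n l - yy K n k) ∣ (yy K n l' - yy K n k') := by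
  rw [dvd_iff_sub K n hkl hl, map_sub, sub_yy K n k (by omega) hl',
    sub_yy K n k (by omega) (by omega), sub_eq_zero]
  intro h
  have := yy_inj K n (by split_ifs <;> omega) (by split_ifs <;> omega) h
  split_ifs at this <;> omega

lemma alp_assoc {p : Fin (n + 1) × Fin (n + 1)} (hp : p.1 < p.2) :
    alp K n p.1 p.2 = yy K n p.2 - yy K n p.1 ∨
    alp K n p.1 p.2 = -(yy K n p.2 - yy K n p.1) := by
  unfold alp
  split_ifs with h
  · left
    rw [varx_eq, h]
    simp [yy_zero]
  · right
    rw [varx_eq, varx_eq]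
    ring

lemma alp_dvd {p : Fin (n + 1) × Fin (n + 1)} (hp : p.1 < p.2) (g : MvPolynomial (Fin n) K) :
    alp K n p.1 p.2 ∣ g ↔ (yy K n p.2 - yy K n p.1) ∣ g := by
  rcases alp_assoc K n hp with h | h <;> rw [h]
  rw [neg_dvd]

lemma dvd_alp {p : Fin (n + 1) × Fin (n + 1)} (hp : p.1 < p.2) (g : MvPolynomial (Fin n) K) :
    g ∣ alp K n p.1 p.2 ↔ g ∣ (yy K n p.2 - yy K n p.1) := by
  rcases alp_assoc K n hp with h | h <;> rw [h]
  rw [dvd_neg]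

lemma mem_DerOf_iff {A : Finset (Fin (n + 1) × Fin (n + 1))} (hA : ∀ p ∈ A, p.1 < p.2)
    (θ : Derivation K (MvPolynomial (Fin n) K) (MvPolynomial (Fin n) K)) :
    θ ∈ DerOf K n (QA K n A) ↔
      ∀ p ∈ A, (yy K n p.2 - yy K n p.1) ∣ θ (yy K n p.2) - θ (yy K n p.1) := by
  have hθ : ∀ p ∈ A, (alp K n p.1 p.2 ∣ θ (alp K n p.1 p.2) ↔
      (yy K n p.2 - yy K n p.1) ∣ θ (yy K n p.2) - θ (yy K n p.1)) := by
    intro p hp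
    rw [alp_dvd K n (hA p hp), ← map_sub]
    rcases alp_assoc K n (hA p hp) with h | h <;> rw [h]
    rw [map_neg, dvd_neg]
  change QA K n A ∣ θ (QA K n A) ↔ _
  constructor
  · intro h p hp
    rw [← hθ p hp]
    have hQ : QA K n A = alp K n p.1 p.2 * ∏ q ∈ A.erase p, alp K n q.1 q.2 :=
      (Finset.mul_prod_erase A (fun q => alp K n q.1 q.2) hp).symm
    have h1 : alp K n p.1 p.2 ∣ θ (QA K n A) := dvd_trans ⟨_, hQ⟩ h
    rw [hQ, Derivation.leibniz, smul_eq_mul, smul_eq_mul] at h1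
    have h2 := (dvd_add_right (Dvd.intro _ rfl)).mp h1
    have hpr := prime_lin K n (hA p hp) (Nat.lt_succ_iff.mp p.2.isLt)
    rw [alp_dvd K n (hA p hp)] at h2 ⊢
    rcases hpr.dvd_or_dvd h2 with h3 | h3
    · exfalso
      rw [hpr.dvd_finsetProd_iff] at h3
      obtain ⟨q, hq, h4⟩ := h3
      obtain ⟨hqp, hq⟩ := Finset.mem_erase.mp hq
      rw [dvd_alp K n (hA q hq)] at h4
      refine not_dvd_lin K n (hA p hp) (Nat.lt_succ_iff.mp p.2.isLt) (hA q hq)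
        (Nat.lt_succ_iff.mp q.2.isLt) ?_ h4
      rintro ⟨e1, e2⟩
      exact hqp (Prod.ext (Fin.ext e1.symm) (Fin.ext e2.symm))
    · exact h3
  · intro h
    have : ∀ B ⊆ A, (∏ p ∈ B, alp K n p.1 p.2) ∣ θ (∏ p ∈ B, alp K n p.1 p.2) := by
      intro B
      induction B using Finset.induction_on with
      | empty => simp
      | insert p B hpB ih =>
        intro hB
        rw [Finset.prod_insert hpB, Derivation.leibniz, smul_eq_mul, smul_eq_mul]
        refine dvd_add (mul_dvd_mul_left _ (ih fun q hq => hB (Finset.mem_insert_of_mem hq))) ?_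
        have hp := hB (Finset.mem_insert_self p B)
        rw [mul_comm]
        exact mul_dvd_mul_left _ ((hθ p hp).mpr (h p hp))
    exact this A subset_rfl

variable {n}

/-- Lower neighbours. -/
def NA (A : Finset (Fin (n + 1) × Fin (n + 1))) (j : ℕ) : Finset ℕ :=
  (A.filter fun p => (p.2 : ℕ) = j).image fun p => (p.1 : ℕ)

lemma mem_NA {A : Finset (Fin (n + 1) × Fin (n + 1))} {j k : ℕ} :
    k ∈ NA A j ↔ ∃ p ∈ A, (p.1 : ℕ) = k ∧ (p.2 : ℕ) = j := by
  simp only [NA, Finset.mem_image, Finset.mem_filter]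
  constructor
  · rintro ⟨p, ⟨h1, h2⟩, h3⟩; exact ⟨p, h1, h3, h2⟩
  · rintro ⟨p, h1, h2, h3⟩; exact ⟨p, ⟨h1, h3⟩, h2⟩

lemma NA_lt {A : Finset (Fin (n + 1) × Fin (n + 1))} (hA : IsSouthwest A) {j k : ℕ}
    (h : k ∈ NA A j) : k < j := by
  obtain ⟨p, hp, rfl, rfl⟩ := mem_NA.mp h
  exact hA.1 p hp

lemma NA_sw {A : Finset (Fin (n + 1) × Fin (n + 1))} (hA : IsSouthwest A) {j k : ℕ} (d : ℕ)
    (hkj : k < j) : k ∈ NA A (j + d) → k ∈ NA A j := by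
  induction d with
  | zero => exact fun h => h
  | succ d ih =>
    intro h
    apply ih
    obtain ⟨p, hp, h1, h2⟩ := mem_NA.mp h
    refine mem_NA.mpr ⟨_, hA.2 p hp (by omega), h1, ?_⟩
    simp only
    omega

lemma good_NA {A : Finset (Fin (n + 1) × Fin (n + 1))} (hA : IsSouthwest A) :
    Good (Finset.Icc 1 n) (NA A) := by
  refine ⟨by simp, fun j _ k hk => NA_lt hA hk, ?_, ?_⟩
  · intro j hj k hk
    have := NA_lt hA hk
    simp only [Finset.mem_Icc] at hj ⊢
    omega
  · intro j _ j' _ hjj k hk hkj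
    obtain ⟨d, rfl⟩ := Nat.exists_eq_add_of_lt hjj
    exact NA_sw hA (d + 1) hkj hk

lemma hseq_eq {A : Finset (Fin (n + 1) × Fin (n + 1))} (hA : IsSouthwest A) (i : Fin n) :
    hseq A i = (NA A (i + 1)).card := by
  rw [hseq]
  refine Finset.card_bij (fun k _ => (k : ℕ)) ?_ ?_ ?_
  · intro k hk
    exact mem_NA.mpr ⟨_, (Finset.mem_filter.mp hk).2.2, rfl, by simp⟩
  · intro a _ b _ h
    exact Fin.ext h
  · intro b hb
    obtain ⟨p, hp, h1, h2⟩ := mem_NA.mp hb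
    have e : p.2 = i.succ := Fin.ext (by simpa using h2)
    refine ⟨p.1, Finset.mem_filter.mpr ⟨Finset.mem_univ _, ?_, ?_⟩, h1⟩
    · rw [← e]; exact hA.1 p hp
    · rw [← e]; exact hp

/-- The basis derivations. -/
def th (A : Finset (Fin (n + 1) × Fin (n + 1))) (j : ℕ) :
    Derivation K (MvPolynomial (Fin n) K) (MvPolynomial (Fin n) K) :=
  mkDerivation K fun i => if j ≤ (i : ℕ) + 1 then ∏ k ∈ NA A j, (X i - yy K n k) else 0

lemma th_yy (A : Finset (Fin (n + 1) × Fin (n + 1))) {j m : ℕ} (hj : 0 < j) (hm : m ≤ n) :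
    th K A j (yy K n m) = if j ≤ m then ∏ k ∈ NA A j, (yy K n m - yy K n k) else 0 := by
  rcases yy_cases n m hm with rfl | ⟨i, rfl⟩
  · rw [if_neg (by omega), yy_zero, map_zero]
  · rw [yy_succ, th, mkDerivation_X]

lemma th_mem {A : Finset (Fin (n + 1) × Fin (n + 1))} (hA : IsSouthwest A) {j : ℕ} (hj : 0 < j) :
    th K A j ∈ DerOf K n (QA K n A) := by
  rw [mem_DerOf_iff K n hA.1]
  intro p hp
  have hlt : (p.1 : ℕ) < p.2 := hA.1 p hp
  have h1 : (p.1 : ℕ) ≤ n := Nat.lt_succ_iff.mp p.1.isLt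
  have h2 : (p.2 : ℕ) ≤ n := Nat.lt_succ_iff.mp p.2.isLt
  rw [th_yy K A hj h1, th_yy K A hj h2]
  by_cases hj1 : j ≤ (p.1 : ℕ)
  · rw [if_pos hj1, if_pos (by omega)]
    have := Polynomial.sub_dvd_eval_sub (yy K n p.2) (yy K n p.1)
      (∏ k ∈ NA A j, (Polynomial.X - Polynomial.C (yy K n k)))
    simpa [Polynomial.eval_prod] using this
  · by_cases hj2 : j ≤ (p.2 : ℕ)
    · rw [if_pos hj2, if_neg hj1, sub_zero]
      obtain ⟨d, hd⟩ := Nat.exists_eq_add_of_le hj2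
      have : (p.1 : ℕ) ∈ NA A j := NA_sw hA d (by omega) (mem_NA.mpr ⟨p, hp, rfl, hd⟩)
      exact Finset.dvd_prod_of_mem (fun k => yy K n p.2 - yy K n k) this
    · rw [if_neg hj1, if_neg hj2]
      simp

lemma iMap_eq (θ : Derivation K (MvPolynomial (Fin n) K) (MvPolynomial (Fin n) K)) :
    iMap K n θ = ∑ l ∈ Finset.Icc 1 n, θ (yy K n l) := by
  change ∑ k : Fin n, θ (X k) = _
  refine Finset.sum_bij (fun k _ => (k : ℕ) + 1) ?_ ?_ ?_ ?_
  · intro k _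
    have := k.isLt
    simp only [Finset.mem_Icc]
    omega
  · intro a _ b _ h
    exact Fin.ext (by omega)
  · intro b hb
    simp only [Finset.mem_Icc] at hb
    exact ⟨⟨b - 1, by omega⟩, Finset.mem_univ _, by simp only; omega⟩
  · intro k _
    rw [yy_succ]

lemma iMap_th (A : Finset (Fin (n + 1) × Fin (n + 1))) {j : ℕ} (hj : 0 < j) :
    iMap K n (th K A j) = Fj (yy K n) (Finset.Icc 1 n) (NA A) j := by
  rw [iMap_eq, Fj, Finset.sum_filter]
  refine Finset.sum_congr rfl fun l hl => ?_
  rw [th_yy K A hj (Finset.mem_Icc.mp hl).2]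

lemma JJ_le {A : Finset (Fin (n + 1) × Fin (n + 1))} (hA : IsSouthwest A) :
    JJ (yy K n) (Finset.Icc 1 n) (NA A) ≤ iIdeal K n A := by
  refine Ideal.span_le.mpr ?_
  rintro s (⟨i, hi, rfl⟩ | ⟨j, hj, rfl⟩)
  · have : yy K n i = 0 := by
      rw [yy, dif_neg]
      intro h
      exact hi (Finset.mem_Icc.mpr h)
    rw [this]
    exact zero_mem _
  · have hj' : 0 < j := (Finset.mem_Icc.mp hj).1
    exact ⟨th K A j, th_mem K hA hj', iMap_th K A hj'⟩

lemma iMap_mem {A : Finset (Fin (n + 1) × Fin (n + 1))} (hA : IsSouthwest A) (d : ℕ) :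
    ∀ c, 0 < c → n + 1 ≤ c + d → ∀ θ ∈ DerOf K n (QA K n A), (∀ m < c, θ (yy K n m) = 0) →
    iMap K n θ ∈ Ideal.span (Set.range fun i : Fin n =>
      Fj (yy K n) (Finset.Icc 1 n) (NA A) (i + 1)) := by
  induction d with
  | zero =>
    intro c hc hcn θ _ h0
    rw [iMap_eq, Finset.sum_eq_zero]
    · exact zero_mem _
    · intro l hl
      have := (Finset.mem_Icc.mp hl).2
      exact h0 l (by omega)
  | succ d ih =>
    intro c hc hcn θ hθ h0
    by_cases hcn' : c ≤ n
    · have hdvd : (∏ k ∈ NA A c, (yy K n c - yy K n k)) ∣ θ (yy K n c) := by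
        refine Finset.prod_dvd_of_isRelPrime ?_ ?_
        · intro k hk k' hk' hkk
          have hk := NA_lt hA hk
          have hk' := NA_lt hA hk'
          refine ((prime_lin K n hk hcn').irreducible.isRelPrime_iff_not_dvd).mpr ?_
          exact not_dvd_lin K n hk hcn' hk' hcn' (fun h => hkk h.1)
        · intro k hk
          have hkc := NA_lt hA hk
          obtain ⟨p, hp, h1, h2⟩ := mem_NA.mp hk
          have := (mem_DerOf_iff K n hA.1 θ).mp hθ p hp
          rw [h1, h2, h0 k hkc, sub_zero] at this
          exact this
      obtain ⟨q, hq⟩ := hdvd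
      have hmem : θ - q • th K A c ∈ DerOf K n (QA K n A) :=
        sub_mem hθ (Submodule.smul_mem _ _ (th_mem K hA hc))
      have h1 := ih (c + 1) (by omega) (by omega) _ hmem (by
        intro m hm
        rw [Derivation.sub_apply, Derivation.smul_apply, th_yy K A hc (by omega)]
        rcases Nat.lt_succ_iff_lt_or_eq.mp hm with h | h
        · rw [if_neg (by omega), h0 m h]
          simp
        · subst h
          rw [if_pos le_rfl, hq, smul_eq_mul]
          ring)
      rw [map_sub, map_smul, iMap_th K A hc, smul_eq_mul] at h1
      have h2 : Fj (yy K n) (Finset.Icc 1 n) (NA A) c ∈ Ideal.span (Set.range fun i : Fin n =>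
          Fj (yy K n) (Finset.Icc 1 n) (NA A) (i + 1)) := by
        refine Ideal.subset_span ⟨⟨c - 1, by omega⟩, ?_⟩
        simp only [Nat.sub_add_cancel hc]
      simpa using add_mem h1 (Ideal.mul_mem_left _ q h2)
    · exact ih c hc (by omega) θ hθ h0

lemma iIdeal_eq {A : Finset (Fin (n + 1) × Fin (n + 1))} (hA : IsSouthwest A) :
    iIdeal K n A = Ideal.span (Set.range fun i : Fin n =>
      Fj (yy K n) (Finset.Icc 1 n) (NA A) (i + 1)) := by
  apply le_antisymm
  · rintro s ⟨θ, hθ, rfl⟩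
    refine iMap_mem K hA n 1 one_pos (by omega) θ hθ ?_
    intro m hm
    rw [Nat.lt_one_iff.mp hm, yy_zero, map_zero]
  · refine Ideal.span_le.mpr ?_
    rintro s ⟨i, rfl⟩
    have := i.isLt
    exact JJ_le K hA (Fj_mem_JJ (Finset.mem_Icc.mpr (by omega)))

lemma yy_hom (i : ℕ) : (yy K n i).IsHomogeneous 1 := by
  unfold yy
  split_ifs
  · exact isHomogeneous_X _ _
  · exact isHomogeneous_zero _ _ _

lemma Fj_hom (A : Finset (Fin (n + 1) × Fin (n + 1))) (j : ℕ) :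
    (Fj (yy K n) (Finset.Icc 1 n) (NA A) j).IsHomogeneous (NA A j).card := by
  refine IsHomogeneous.sum _ _ _ fun l _ => ?_
  have := IsHomogeneous.prod (NA A j) (fun k => yy K n l - yy K n k) (fun _ => 1)
    fun k _ => (yy_hom K l).sub (yy_hom K k)
  simpa using this

lemma Mon_le {A : Finset (Fin (n + 1) × Fin (n + 1))} (hA : IsSouthwest A) :
    Mon (yy K n) (Finset.Icc 1 n) (NA A) ⊆ Red K (hseq A) := by
  rintro s ⟨a, ha, rfl⟩
  refine ⟨Finsupp.equivFunOnFinite.symm fun i => a (i + 1), ?_, ?_⟩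
  · intro i
    have := i.isLt
    rw [hseq_eq hA]
    exact ha (i + 1) (Finset.mem_Icc.mpr (by omega))
  · rw [monomial_eq, Finsupp.prod_fintype _ _ (by simp)]
    simp only [map_one, one_mul]
    symm
    refine Finset.prod_bij (fun k _ => (k : ℕ) + 1) ?_ ?_ ?_ ?_
    · intro k _
      have := k.isLt
      simp only [Finset.mem_Icc]
      omega
    · intro a _ b _ h
      exact Fin.ext (by omega)
    · intro b hb
      simp only [Finset.mem_Icc] at hb
      exact ⟨⟨b - 1, by omega⟩, Finset.mem_univ _, by simp only; omega⟩
    · intro k _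
      rw [yy_succ]
      rfl

lemma final_span [CharZero K] {A : Finset (Fin (n + 1) × Fin (n + 1))} (hA : IsSouthwest A)
    (g : MvPolynomial (Fin n) K) :
    ∃ u ∈ Submodule.span K (Red K (hseq A)), g - u ∈ iIdeal K n A := by
  have hgen : Algebra.adjoin K (Set.range (yy K n)) = ⊤ := by
    rw [eq_top_iff, ← MvPolynomial.adjoin_range_X]
    apply Algebra.adjoin_mono
    rintro s ⟨i, rfl⟩
    exact ⟨i + 1, yy_succ K n i⟩
  obtain ⟨u, hu, h⟩ := spanning (K := K) (yy K n) (yy_zero K n) hgen _ _ _ (good_NA hA) le_rfl g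
  exact ⟨u, Submodule.span_mono (Mon_le K hA) hu, JJ_le K hA h⟩

lemma final_indep [CharZero K] {A : Finset (Fin (n + 1) × Fin (n + 1))} (hA : IsSouthwest A)
    (hpos : ∀ i, 0 < hseq A i) {u : MvPolynomial (Fin n) K}
    (hu : u ∈ Submodule.span K (Red K (hseq A))) (huI : u ∈ iIdeal K n A) : u = 0 := by
  have hs := final_span K hA
  rw [iIdeal_eq K hA] at huI
  simp only [iIdeal_eq K hA] at hs
  refine red_zero hpos (fun i => ?_) hs hu huI
  rw [hseq_eq hA]
  exact Fj_hom K A _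

end Der

end SWProof

theorem statement14 (K : Type*) [Field K] [CharZero K] (n : ℕ) (hn : 0 < n)
    (A : Finset (Fin (n + 1) × Fin (n + 1))) (hA : IsSouthwest A)
    (hess : Submodule.span K {f : MvPolynomial (Fin n) K | ∃ p ∈ A, f = alp K n p.1 p.2} =
      Submodule.span K (Set.range (X : Fin n → MvPolynomial (Fin n) K))) :
    LinearIndependent K
      (fun a : { a : Fin n → ℕ // ∀ i, a i < hseq A i } =>
        Ideal.Quotient.mk (iIdeal K n A)
          (monomial (Finsupp.equivFunOnFinite.symm a.1) (1 : K))) ∧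
    Submodule.span K
      (Set.range fun a : { a : Fin n → ℕ // ∀ i, a i < hseq A i } =>
        Ideal.Quotient.mk (iIdeal K n A)
          (monomial (Finsupp.equivFunOnFinite.symm a.1) (1 : K))) = ⊤ := by
  have hred : Set.range (fun a : { a : Fin n → ℕ // ∀ i, a i < hseq A i } =>
      (monomial (Finsupp.equivFunOnFinite.symm a.1) (1 : K) : MvPolynomial (Fin n) K))
      = SWProof.Red K (hseq A) := by
    ext s
    constructor
    · rintro ⟨a, rfl⟩
      exact ⟨_, a.2, rfl⟩
    · rintro ⟨c, hc, rfl⟩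
      refine ⟨⟨c, hc⟩, ?_⟩
      have e : Finsupp.equivFunOnFinite.symm (c : Fin n → ℕ) = c := Finsupp.ext fun i => rfl
      simp only [e]
  constructor
  · by_cases hpos : ∀ i, 0 < hseq A i
    · have hli : LinearIndependent K (fun a : { a : Fin n → ℕ // ∀ i, a i < hseq A i } =>
          (monomial (Finsupp.equivFunOnFinite.symm a.1) (1 : K) : MvPolynomial (Fin n) K)) := by
        have := (basisMonomials (Fin n) K).linearIndependent.comp
          (fun a : { a : Fin n → ℕ // ∀ i, a i < hseq A i } => Finsupp.equivFunOnFinite.symm a.1)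
          (fun a b h => Subtype.ext (Finsupp.equivFunOnFinite.symm.injective h))
        rw [coe_basisMonomials] at this
        exact this
      refine hli.map (f := (Ideal.Quotient.mkₐ K (iIdeal K n A)).toLinearMap) ?_
      rw [hred, Submodule.disjoint_def]
      intro u hu hk
      exact SWProof.final_indep K hA hpos hu (Ideal.Quotient.eq_zero_iff_mem.mp hk)
    · have : IsEmpty { a : Fin n → ℕ // ∀ i, a i < hseq A i } := by
        push Not at hpos
        obtain ⟨i, hi⟩ := hpos
        exact ⟨fun a => by have := a.2 i; omega⟩
      exact linearIndependent_empty_type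
  · rw [eq_top_iff]
    rintro s -
    obtain ⟨g, rfl⟩ := Ideal.Quotient.mk_surjective s
    obtain ⟨u, hu, hgu⟩ := SWProof.final_span K hA g
    rw [Ideal.Quotient.eq.mpr hgu]
    have h1 := Submodule.mem_map_of_mem
      (f := (Ideal.Quotient.mkₐ K (iIdeal K n A)).toLinearMap) hu
    rw [← hred, Submodule.map_span, ← Set.range_comp] at h1
    exact h1
end
end
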